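/- arXiv:2503.23582 — 2 statements merged into one kernel-verified Lean document; each statement's English description precedes it below -/
import Mathlib

section
/- Let f : ℕ → ℕ be an unbounded nondecreasing function. Suppose there exists a function g : ℕ → ℕ with f(g(n)) = n for all n ∈ ℕ, and a constant M ∈ ℕ such that g(Mn) ≥ 93·g(n) for all n ∈ ℕ. Then there exists a lawless group Γ generated by a finite set S such that 𝒜_Γ^S ≈ f. -/
/-- The length of the reduced word representing an element of the free group. -/
def wordLen {k : ℕ} (w : FreeGroup (Fin k)) : ℕ := w.toWord.length

/-- `w ∈ F_k` is a law for `Γ` if it vanishes under every evaluation in `Γ`. -/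
def IsLaw (Γ : Type*) [Group Γ] {k : ℕ} (w : FreeGroup (Fin k)) : Prop :=
  ∀ g : Fin k → Γ, FreeGroup.lift g w = 1

/-- A group is lawless if for every `k` no nontrivial element of `F_k` is a law for it. -/
def IsLawless (Γ : Type*) [Group Γ] : Prop :=
  ∀ (k : ℕ) (w : FreeGroup (Fin k)), w ≠ 1 → ¬ IsLaw Γ w

/-- Word length of `g` with respect to a generating set `S`: the least `n` such that `g`
is a product of `n` elements of `S ∪ S⁻¹`. -/
noncomputable def wlen {Γ : Type*} [Group Γ] (S : Set Γ) (g : Γ) : ℕ :=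
  sInf {n | ∃ f : Fin n → Γ, (∀ i, f i ∈ S ∨ (f i)⁻¹ ∈ S) ∧ (List.ofFn f).prod = g}

/-- The complexity `χ_Γ^S(w)`: the least total word length of a tuple on which `w`
does not vanish. -/
noncomputable def chi {Γ : Type*} [Group Γ] (S : Set Γ) {k : ℕ} (w : FreeGroup (Fin k)) : ℕ :=
  sInf {c | ∃ g : Fin k → Γ, FreeGroup.lift g w ≠ 1 ∧ c = ∑ i, wlen S (g i)}

/-- The lawlessness growth function `𝒜_Γ^S`. -/
noncomputable def lawGrowth {Γ : Type*} [Group Γ] (S : Set Γ) (l : ℕ) : ℕ :=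
  sSup {c | ∃ w : FreeGroup (Fin 2), w ≠ 1 ∧ wordLen w ≤ l ∧ c = chi S w}

/-- `F₁ ⪯ F₂` : there is `K ∈ ℕ` with `F₁(l) ≤ K·F₂(K·l)` for all `l`. -/
def Preceq (F₁ F₂ : ℕ → ℕ) : Prop :=
  ∃ K : ℕ, 1 ≤ K ∧ ∀ l : ℕ, 1 ≤ l → F₁ l ≤ K * F₂ (K * l)

/-- Equivalence of growth functions. -/
def EquivGrowth (F₁ F₂ : ℕ → ℕ) : Prop := Preceq F₁ F₂ ∧ Preceq F₂ F₁

section LawlessnessGrowth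

open FreeGroup hiding map_mul map_one map_inv norm_mul_le IsReduced norm
open scoped commutatorElement

/-! ### A self-embedding of the free group of rank two -/

/-- A word in the second derived subgroup whose reduced form begins and ends with `of i`. -/
def metabelianLaw (i : Fin 2) : FreeGroup (Fin 2) :=
  ⁅⁅of i, (of (i + 1))⁻¹⁆, ⁅(of i)⁻¹, (of (i + 1))⁻¹⁆⁆

/-- The endomorphism of the free group of rank two with values in the second derived subgroup
that sends the generators to `metabelianLaw`. -/
def metabelianEnd : FreeGroup (Fin 2) →* FreeGroup (Fin 2) := lift metabelianLaw

/-- The reduced word of the image of a letter under `metabelianEnd`. -/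
def metabelianWord (c : Fin 2 × Bool) : List (Fin 2 × Bool) :=
  (cond c.2 (metabelianLaw c.1) (metabelianLaw c.1)⁻¹).toWord

lemma metabelianWord_ne_nil (c : Fin 2 × Bool) : metabelianWord c ≠ [] := by
  revert c
  decide

lemma isReduced_flatMap_metabelianWord {L : List (Fin 2 × Bool)} (hL : FreeGroup.IsReduced L) :
    FreeGroup.IsReduced (L.flatMap metabelianWord) := by
  have hne : [] ∉ L.map metabelianWord := by
    simp only [List.mem_map, not_exists, not_and]
    exact fun c _ => metabelianWord_ne_nil c
  rw [List.flatMap_def, FreeGroup.IsReduced, List.isChain_flatten hne]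
  refine ⟨?_, ?_⟩
  · simp only [List.mem_map, forall_exists_index, and_imp, forall_apply_eq_imp_iff₂]
    exact fun c _ => isReduced_toWord
  · rw [List.isChain_map]
    refine List.IsChain.imp ?_ hL
    decide

lemma metabelianEnd_mk (L : List (Fin 2 × Bool)) :
    metabelianEnd (mk L) = mk (L.flatMap metabelianWord) := by
  induction L with
  | nil => rfl
  | cons c L ih =>
    have h : (mk (c :: L) : FreeGroup (Fin 2)) = mk [c] * mk L := by simp
    rw [h, map_mul, ih, List.flatMap_cons, ← mul_mk]
    congr 1
    obtain ⟨i, b⟩ := c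
    rw [metabelianWord, mk_toWord, metabelianEnd, lift_mk]
    simp

lemma metabelianEnd_ne_one {w : FreeGroup (Fin 2)} (hw : w ≠ 1) : metabelianEnd w ≠ 1 := by
  intro h
  apply hw
  rw [← mk_toWord (x := w), metabelianEnd_mk] at h
  have h2 := congrArg toWord h
  rw [toWord_mk, (isReduced_flatMap_metabelianWord isReduced_toWord).reduce_eq, toWord_one,
    List.flatMap_eq_nil_iff] at h2
  rw [← toWord_eq_nil_iff, List.eq_nil_iff_forall_not_mem]
  exact fun c hc => metabelianWord_ne_nil c (h2 c hc)

lemma norm_metabelianLaw (i : Fin 2) : (metabelianLaw i).norm ≤ 14 := by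
  revert i
  decide

lemma map_lift_derivedSeries_le {α G : Type*} [Group G] {f : α → G} {m : ℕ}
    (hf : ∀ a, f a ∈ derivedSeries G m) (d : ℕ) :
    (derivedSeries (FreeGroup α) d).map (lift f) ≤ derivedSeries G (m + d) := by
  induction d with
  | zero =>
    rw [derivedSeries_zero, ← MonoidHom.range_eq_map, range_lift_eq_closure, Subgroup.closure_le]
    rintro _ ⟨a, rfl⟩
    exact hf a
  | succ d ih =>
    rw [derivedSeries_succ, Subgroup.map_commutator]
    exact Subgroup.commutator_mono ih ih

lemma metabelianLaw_mem (i : Fin 2) : metabelianLaw i ∈ derivedSeries (FreeGroup (Fin 2)) 2 :=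
  Subgroup.commutator_mem_commutator
    (Subgroup.commutator_mem_commutator (Subgroup.mem_top _) (Subgroup.mem_top _))
    (Subgroup.commutator_mem_commutator (Subgroup.mem_top _) (Subgroup.mem_top _))

lemma metabelianEnd_mem {d : ℕ} {w : FreeGroup (Fin 2)}
    (hw : w ∈ derivedSeries (FreeGroup (Fin 2)) d) :
    metabelianEnd w ∈ derivedSeries (FreeGroup (Fin 2)) (d + 1) :=
  derivedSeries_antitone _ (by omega : d + 1 ≤ 2 + d)
    (map_lift_derivedSeries_le metabelianLaw_mem d (Subgroup.mem_map_of_mem _ hw))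

lemma norm_lift_le {α β : Type*} [DecidableEq α] [DecidableEq β] {f : α → FreeGroup β} {B : ℕ}
    (hf : ∀ a, (f a).norm ≤ B) (w : FreeGroup α) : (lift f w).norm ≤ w.norm * B := by
  suffices h : ∀ L : List (α × Bool), (lift f (mk L)).norm ≤ L.length * B by
    have := h w.toWord
    rwa [mk_toWord] at this
  intro L
  rw [lift_mk]
  induction L with
  | nil => simp
  | cons c L ih =>
    rw [List.map_cons, List.prod_cons, List.length_cons, add_mul, one_mul, add_comm]
    refine (FreeGroup.norm_mul_le _ _).trans (add_le_add ?_ ih)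
    obtain ⟨a, _ | _⟩ := c
    all_goals simpa using hf a

/-! ### Lengths of elements of the derived series of a free group -/

section CoverCocycle

variable {α : Type*} [DecidableEq α] (K : Subgroup (FreeGroup α)) [K.Normal]

open Classical in
/-- The homomorphism to a wreath product whose base component counts, modulo two, the passages
of a path in the Cayley graph of `FreeGroup α ⧸ K` through the edge labelled `s₀` at `q₀`. -/
noncomputable def coverHom (s₀ : α) (q₀ : FreeGroup α ⧸ K) :
    FreeGroup α →* Multiplicative (ZMod 2) ≀ᵣ (FreeGroup α ⧸ K) :=
  lift fun s => ⟨fun q => if s = s₀ ∧ q = q₀ then Multiplicative.ofAdd 1 else 1,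
    QuotientGroup.mk (of s)⟩

lemma coverHom_right (s₀ : α) (q₀ : FreeGroup α ⧸ K) (w : FreeGroup α) :
    (coverHom K s₀ q₀ w).right = QuotientGroup.mk w := by
  have h : RegularWreathProduct.rightHom.comp (coverHom K s₀ q₀) = QuotientGroup.mk' K := by
    ext s
    simp [coverHom]
  exact DFunLike.congr_fun h w

lemma coverHom_commutator (s₀ : α) (q₀ : FreeGroup α ⧸ K) :
    ⁅K, K⁆ ≤ (coverHom K s₀ q₀).ker := by
  rw [Subgroup.commutator_le]
  intro g hg h hh
  have hg' := (coverHom_right K s₀ q₀ g).trans ((QuotientGroup.eq_one_iff g).2 hg)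
  have hh' := (coverHom_right K s₀ q₀ h).trans ((QuotientGroup.eq_one_iff h).2 hh)
  rw [MonoidHom.mem_ker, map_commutatorElement, commutatorElement_eq_one_iff_mul_comm]
  ext x
  · simp only [RegularWreathProduct.mul_left, hg', hh', inv_one, one_mul]
    rw [mul_comm]
  · simp [hg', hh']

lemma coverHom_letter_left (s₀ : α) (q₀ : FreeGroup α ⧸ K) (c : α × Bool)
    (q : FreeGroup α ⧸ K)
    (h : ¬ (c.1 = s₀ ∧ cond c.2 q (QuotientGroup.mk (of c.1) * q) = q₀)) :
    (coverHom K s₀ q₀ (mk [c])).left q = 1 := by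
  obtain ⟨s, _ | _⟩ := c
  · simp_all [coverHom]
  · simp_all [coverHom]

lemma coverHom_letter_left_ne (s₀ : α) (q₀ : FreeGroup α ⧸ K) (b : Bool)
    (q : FreeGroup α ⧸ K) (h : cond b q (QuotientGroup.mk (of s₀) * q) = q₀) :
    (coverHom K s₀ q₀ (mk [(s₀, b)])).left q ≠ 1 := by
  cases b
  · simp_all [coverHom]
  · simp_all [coverHom]

lemma coverHom_left_eq_one (s₀ : α) (q₀ : FreeGroup α ⧸ K) (L : List (α × Bool))
    (q : FreeGroup α ⧸ K)
    (h : ∀ A c B, L = A ++ c :: B →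
      (coverHom K s₀ q₀ (mk [c])).left (QuotientGroup.mk (mk A)⁻¹ * q) = 1) :
    (coverHom K s₀ q₀ (mk L)).left q = 1 := by
  induction L generalizing q with
  | nil => simp [← one_eq_mk]
  | cons c L ih =>
    have e : (mk (c :: L) : FreeGroup α) = mk [c] * mk L := by simp
    rw [e, map_mul, RegularWreathProduct.mul_left, Pi.mul_apply, coverHom_right]
    have h0 := h [] c L rfl
    rw [← one_eq_mk, inv_one, QuotientGroup.mk_one, one_mul] at h0
    rw [h0, one_mul]
    apply ih
    rintro A d B rfl
    have h1 := h (c :: A) d B rfl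
    have e : (mk (c :: A) : FreeGroup α) = mk [c] * mk A := by simp
    rwa [e, mul_inv_rev, QuotientGroup.mk_mul, mul_assoc, QuotientGroup.mk_inv K (mk [c])] at h1

lemma notMem_commutator_of_norm_min {w : FreeGroup α} (hw : w ≠ 1)
    (hmin : ∀ u ∈ K, u ≠ 1 → w.norm ≤ u.norm) : w ∉ ⁅K, K⁆ := by
  intro hmem
  obtain ⟨L, hL, rfl⟩ : ∃ L, FreeGroup.IsReduced L ∧ mk L = w :=
    ⟨w.toWord, isReduced_toWord, mk_toWord⟩
  have hlen : (mk L).norm = L.length := by rw [FreeGroup.norm, toWord_mk, hL.reduce_eq]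
  rw [hlen] at hmin
  have hsub : ∀ A : List (α × Bool), FreeGroup.IsReduced A → A.length < L.length →
      mk A ∈ K → A = [] := by
    intro A hA hAL hAK
    by_contra hne
    have h1 : mk A ≠ 1 := by
      rwa [Ne, ← toWord_eq_nil_iff, toWord_mk, hA.reduce_eq]
    exact absurd (hmin _ hAK h1) (by have := norm_mk_le (L₁ := A); omega)
  cases L with
  | nil => exact hw one_eq_mk.symm
  | cons c L =>
    obtain ⟨s, b⟩ := c
    set q₀ : FreeGroup α ⧸ K := cond b 1 (QuotientGroup.mk (of s) * 1) with hq₀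
    have h1 := coverHom_commutator K s q₀ hmem
    have e : (mk ((s, b) :: L) : FreeGroup α) = mk [(s, b)] * mk L := by simp
    have h2 := congrFun (congrArg RegularWreathProduct.left (MonoidHom.mem_ker.1 h1)) 1
    rw [e, map_mul, RegularWreathProduct.mul_left, Pi.mul_apply, coverHom_right,
      coverHom_left_eq_one K s q₀ L, mul_one] at h2
    · exact coverHom_letter_left_ne K s q₀ b 1 hq₀.symm h2
    rintro A ⟨s', b'⟩ B rfl
    apply coverHom_letter_left
    rintro ⟨rfl, hq⟩
    rw [mul_one, ← QuotientGroup.mk_inv, ← QuotientGroup.mk_mul] at hq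
    have hA : FreeGroup.IsReduced ((s', b) :: A) := by
      have : (s', b) :: (A ++ (s', b') :: B) = ((s', b) :: A) ++ (s', b') :: B := rfl
      rw [this] at hL
      exact (List.isChain_append.1 hL).1
    have hlt : ((s', b) :: A).length < ((s', b) :: (A ++ (s', b') :: B)).length := by
      simp
    have hsame : (QuotientGroup.mk ((mk A)⁻¹ * (mk [(s', b)])⁻¹) : FreeGroup α ⧸ K) = 1 →
        False := by
      intro h
      rw [QuotientGroup.eq_one_iff, ← mul_inv_rev, inv_mem_iff, mul_mk] at h
      exact List.cons_ne_nil _ _ (hsub _ hA hlt h)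
    have hopp : mk A ∈ K → b ≠ b' → False := by
      intro h hb
      have hA0 := hsub A (List.isChain_of_isChain_cons hA) (by simp) h
      subst hA0
      have := (List.isChain_cons_cons.1 hL).1 rfl
      exact hb this
    have hinv : ∀ x : FreeGroup α, (QuotientGroup.mk ((mk A)⁻¹ * x) : FreeGroup α ⧸ K) =
        QuotientGroup.mk x → mk A ∈ K := by
      intro x hx
      rwa [QuotientGroup.mk_mul, mul_eq_right, QuotientGroup.eq_one_iff, inv_mem_iff] at hx
    cases b <;> cases b'
    · refine hsame ?_
      simp only [hq₀, cond_false, mul_one] at hq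
      rwa [mul_eq_left] at hq
    · refine hopp (hinv (of s') ?_) (by simp)
      have e' : (mk [(s', false)])⁻¹ = of s' := rfl
      rwa [e', hq₀, cond_false, mul_one] at hq
    · refine hopp (hinv (of s')⁻¹ ?_) (by simp)
      simp only [hq₀, cond_false, cond_true] at hq
      rw [mul_eq_one_iff_eq_inv'] at hq
      exact hq
    · exact hsame hq

end CoverCocycle

lemma le_norm_of_mem_derivedSeries {α : Type*} [DecidableEq α] (d : ℕ) {w : FreeGroup α}
    (hw : w ∈ derivedSeries (FreeGroup α) d) (h1 : w ≠ 1) : d ≤ w.norm := by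
  induction d generalizing w with
  | zero => exact Nat.zero_le _
  | succ d ih =>
    have h2 := ih (derivedSeries_antitone _ d.le_succ hw) h1
    by_contra hlt
    have := derivedSeries_normal (FreeGroup α) d
    refine notMem_commutator_of_norm_min (derivedSeries (FreeGroup α) d) h1 (fun u hu hu1 => ?_) hw
    have := ih hu hu1
    omega

/-! ### Wreath products with the integers -/

section Wreath

open Multiplicative RegularWreathProduct

lemma derivedSeries_wreath_le (H Q : Type*) [Group H] [CommGroup Q] (d : ℕ) {p : H ≀ᵣ Q}
    (hp : p ∈ derivedSeries (H ≀ᵣ Q) (d + 1)) :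
    p.right = 1 ∧ ∀ i, p.left i ∈ derivedSeries H d := by
  induction d generalizing p with
  | zero =>
    refine ⟨?_, fun i => Subgroup.mem_top _⟩
    have h := Subgroup.commutator_le.2
      (fun g (_ : g ∈ (⊤ : Subgroup (H ≀ᵣ Q))) h (_ : h ∈ (⊤ : Subgroup (H ≀ᵣ Q))) =>
        show ⁅g, h⁆ ∈ (rightHom (D := H) (Q := Q)).ker by
          rw [MonoidHom.mem_ker, map_commutatorElement, commutatorElement_eq_one_iff_mul_comm,
            mul_comm])
    exact h hp
  | succ d ih =>
    let B : Subgroup (H ≀ᵣ Q) :=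
      { carrier := {p | p.right = 1 ∧ ∀ i, p.left i ∈ derivedSeries H (d + 1)}
        mul_mem' := by
          rintro a b ⟨ha, ha'⟩ ⟨hb, hb'⟩
          refine ⟨by simp [ha, hb], fun i => ?_⟩
          simpa using mul_mem (ha' i) (hb' _)
        one_mem' := ⟨rfl, fun i => one_mem _⟩
        inv_mem' := by
          rintro a ⟨ha, ha'⟩
          refine ⟨by simp [ha], fun i => ?_⟩
          simpa using ha' _ }
    have h : derivedSeries (H ≀ᵣ Q) (d + 1 + 1) ≤ B := by
      rw [derivedSeries_succ, Subgroup.commutator_le]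
      intro a ha b hb
      obtain ⟨ha1, ha2⟩ := ih ha
      obtain ⟨hb1, hb2⟩ := ih hb
      refine ⟨by simp [commutatorElement_def, ha1, hb1], fun i => ?_⟩
      have : (⁅a, b⁆).left i = ⁅a.left i, b.left i⁆ := by
        simp [commutatorElement_def, ha1, hb1]
      rw [this]
      exact Subgroup.commutator_mem_commutator (ha2 i) (hb2 i)
    exact h hp

lemma eq_one_of_mem_derivedSeries_wreath {H Q : Type*} [Group H] [CommGroup Q] {d : ℕ}
    (hd : derivedSeries H d = ⊥) {p : H ≀ᵣ Q} (hp : p ∈ derivedSeries (H ≀ᵣ Q) (d + 1)) :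
    p = 1 := by
  obtain ⟨h1, h2⟩ := derivedSeries_wreath_le H Q d hp
  ext i
  · simpa [hd] using h2 i
  · exact h1

/-- The embedding of a group into its wreath product with `ℤ`, as the factor at position `n`. -/
def wreathSingle (H : Type*) [Group H] (n : ℤ) : H →* H ≀ᵣ Multiplicative ℤ where
  toFun h := ⟨Pi.mulSingle (ofAdd n) h, 1⟩
  map_one' := by ext <;> simp
  map_mul' a b := by ext <;> simp [Pi.mulSingle_mul]

lemma wreathSingle_injective (H : Type*) [Group H] (n : ℤ) :
    Function.Injective (wreathSingle H n) := fun a b h => by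
  simpa [wreathSingle] using congrFun (congrArg RegularWreathProduct.left h) (ofAdd n)

/-- The images of the three generators: the shift, `x` at position `0` and `y` at position `n`. -/
def wreathGen {H : Type*} [Group H] (x y : H) (n : ℤ) : Fin 3 → H ≀ᵣ Multiplicative ℤ :=
  ![inl (ofAdd 1), wreathSingle H 0 x, wreathSingle H n y]

/-- Two elements of the free group of rank three which, under `lift (wreathGen x y n)`, map to
`x` and `y` at position `0`. -/
def coupledPair (n : ℕ) : Fin 2 → FreeGroup (Fin 3) :=
  ![of 1, (of 0 ^ n)⁻¹ * of 2 * of 0 ^ n]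

lemma lift_wreathGen_coupledPair {H : Type*} [Group H] (x y : H) (n : ℕ) (w : FreeGroup (Fin 2)) :
    lift (wreathGen x y n) (lift (coupledPair n) w) = wreathSingle H 0 (lift ![x, y] w) := by
  have h : (lift (wreathGen x y n)).comp (lift (coupledPair n)) =
      (wreathSingle H 0).comp (lift ![x, y]) := by
    ext1 i
    fin_cases i
    · simp [wreathGen, coupledPair]
    · have h2 : (inl (ofAdd (1 : ℤ)) : H ≀ᵣ Multiplicative ℤ) ^ n = inl (ofAdd (n : ℤ)) := by
        rw [← map_pow, ← ofAdd_nsmul, nsmul_one]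
      simp only [wreathGen, coupledPair, MonoidHom.comp_apply, lift_apply_of, Fin.mk_one,
        Matrix.cons_val_one, Matrix.cons_val_zero, Matrix.cons_val_fin_one, map_mul, map_inv,
        map_pow, Matrix.cons_val, h2]
      ext i
      · simp only [wreathSingle, mul_left, inv_left, inl, MonoidHom.coe_mk, OneHom.coe_mk,
          Pi.mul_apply, inv_right, Pi.inv_apply, Pi.one_apply, inv_one, one_mul,
          mul_one, inv_inv, Pi.mulSingle_apply]
        congr 1
        rw [eq_iff_iff, ← toAdd.injective.eq_iff, ← toAdd.injective.eq_iff]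
        simp
      · simp [wreathSingle]
  exact DFunLike.congr_fun h w

lemma left_lift_eq_of_agree {α H H' : Type*} [Group H] [Group H']
    {f : α → H ≀ᵣ Multiplicative ℤ} {f' : α → H' ≀ᵣ Multiplicative ℤ} (e : H' →* H)
    {p : ℤ → Prop} (hr : ∀ a, (f a).right = (f' a).right)
    (hr1 : ∀ a, |toAdd (f a).right| ≤ 1)
    (hl : ∀ a m, p m → (f a).left (ofAdd m) = e ((f' a).left (ofAdd m)))
    (L : List (α × Bool)) (i : ℤ) (hi : ∀ m, |m - i| ≤ L.length → p m) :
    (lift f (mk L)).left (ofAdd i) = e ((lift f' (mk L)).left (ofAdd i)) := by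
  induction L generalizing i with
  | nil => simp [← one_eq_mk]
  | cons c L ih =>
    simp only [lift_mk, List.map_cons, List.prod_cons, List.length_cons, Nat.cast_add,
      Nat.cast_one] at ih hi ⊢
    obtain ⟨a, b⟩ := c
    have h1 := abs_le.1 (hr1 a)
    have hlen : (0 : ℤ) ≤ L.length := Nat.cast_nonneg _
    cases b
    · simp only [cond_false, mul_left, inv_left, inv_right, Pi.mul_apply, Pi.inv_apply, inv_inv,
        ← hr, map_mul, map_inv]
      have e1 : (f a).right * ofAdd i = ofAdd (toAdd (f a).right + i) := rfl
      rw [e1, hl a, ih]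
      · intro m hm
        apply hi
        rw [abs_le] at hm ⊢
        constructor <;> linarith
      · apply hi
        rw [abs_le]
        constructor <;> linarith
    · simp only [cond_true, mul_left, Pi.mul_apply, ← hr, map_mul]
      have e1 : (f a).right⁻¹ * ofAdd i = ofAdd (-toAdd (f a).right + i) := rfl
      rw [e1, hl a, ih]
      · intro m hm
        apply hi
        rw [abs_le] at hm ⊢
        constructor <;> linarith
      · apply hi
        rw [abs_le]
        constructor <;> linarith

lemma lift_wreathGen_eq_one_of_mem {H : Type*} [Group H] (x y : H) {n : ℕ}
    {w : FreeGroup (Fin 3)} (hw : w ∈ derivedSeries (FreeGroup (Fin 3)) 2)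
    (hn : 2 * w.norm < n) : lift (wreathGen x y n) w = 1 := by
  have hcomm : derivedSeries (Multiplicative ℤ) 1 = ⊥ := by
    rw [derivedSeries_one, commutator_eq_bot_iff_center_eq_top, CommGroup.center_eq_top]
  have hab : ∀ f : Fin 3 → Multiplicative ℤ ≀ᵣ Multiplicative ℤ, lift f w = 1 := fun f =>
    eq_one_of_mem_derivedSeries_wreath hcomm
      (map_derivedSeries_le_derivedSeries (lift f) 2 (Subgroup.mem_map_of_mem _ hw))
  have hr1 : ∀ a, |toAdd (wreathGen x y n a).right| ≤ 1 := by
    intro a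
    fin_cases a <;> simp [wreathGen, wreathSingle]
  ext i
  · by_cases hi : ∀ m, |m - toAdd i| ≤ w.toWord.length → m ≠ n
    · have h := left_lift_eq_of_agree (f := wreathGen x y n)
        (f' := wreathGen (ofAdd 1) 1 n) (zpowersHom H x) (fun a => ?_) hr1 ?_ w.toWord (toAdd i) hi
      · rw [mk_toWord, hab, one_left, Pi.one_apply, map_one] at h
        exact h
      · fin_cases a <;> rfl
      · intro a m hm
        fin_cases a
        · simp [wreathGen]
        · by_cases h0 : m = 0
          · simp [wreathGen, wreathSingle, h0]
          · simp [wreathGen, wreathSingle, h0]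
        · simp [wreathGen, wreathSingle, hm]
    · have hi' : ∀ m, |m - toAdd i| ≤ w.toWord.length → m ≠ 0 := by
        push Not at hi
        obtain ⟨m, hm, rfl⟩ := hi
        rintro m' hm' rfl
        have hn' : 2 * (w.toWord.length : ℤ) < n := by exact_mod_cast hn
        rw [abs_le] at hm hm'
        linarith
      have h := left_lift_eq_of_agree (f := wreathGen x y n)
        (f' := wreathGen 1 (ofAdd 1) n) (zpowersHom H y) (fun a => ?_) hr1 ?_ w.toWord (toAdd i) hi'
      · rw [mk_toWord, hab, one_left, Pi.one_apply, map_one] at h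
        exact h
      · fin_cases a <;> rfl
      · intro a m hm
        fin_cases a
        · simp [wreathGen]
        · simp [wreathGen, wreathSingle, hm]
        · by_cases h0 : m = n
          · simp [wreathGen, wreathSingle, h0]
          · simp [wreathGen, wreathSingle, h0]
  · exact (derivedSeries_wreath_le H _ 1
      (map_derivedSeries_le_derivedSeries (lift (wreathGen x y n)) 2
        (Subgroup.mem_map_of_mem _ hw))).1

end Wreath

lemma exists_injective_freeGroup_fin_two (k : ℕ) :
    ∃ ψ : FreeGroup (Fin k) →* FreeGroup (Fin 2), Function.Injective ψ := by
  let σ : MulAut (FreeGroup ℤ) := freeGroupCongr (Equiv.addRight 1)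
  let φ : Multiplicative ℤ →* MulAut (FreeGroup ℤ) := zpowersHom _ σ
  have hσ : ∀ i : ℕ, (σ ^ i) (of 0) = of (i : ℤ) := by
    intro i
    induction i with
    | zero => simp
    | succ i ih =>
      rw [pow_succ', MulAut.mul_apply, ih]
      simp [σ]
  let ψ : FreeGroup (Fin k) →* FreeGroup (Fin 2) :=
    lift fun i => of 1 ^ (i : ℕ) * of 0 * (of 1 ^ (i : ℕ))⁻¹
  let χ : FreeGroup (Fin 2) →* FreeGroup ℤ ⋊[φ] Multiplicative ℤ :=
    lift ![SemidirectProduct.inl (of 0), SemidirectProduct.inr (Multiplicative.ofAdd 1)]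
  refine ⟨ψ, fun a b hab => ?_⟩
  have h : χ.comp ψ = SemidirectProduct.inl.comp (map fun i : Fin k => ((i : ℕ) : ℤ)) := by
    ext1 i
    have h1 : φ (Multiplicative.ofAdd 1 ^ (i : ℕ)) (of 0) = of ((i : ℕ) : ℤ) := by
      rw [map_pow, ← hσ]
      simp [φ]
    simp only [MonoidHom.comp_apply, ψ, χ, lift_apply_of, map_mul, map_pow, map_inv,
      Matrix.cons_val_zero, Matrix.cons_val_one, Matrix.cons_val_fin_one, map.of]
    rw [← h1, SemidirectProduct.inl_aut, map_inv, map_pow]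
  have h2 : Function.Injective (χ.comp ψ) := by
    rw [h]
    refine SemidirectProduct.inl_injective.comp (map_injective fun i j hij => ?_)
    exact Fin.ext (by exact_mod_cast hij)
  exact h2 (congrArg χ hab)

/-! ### Word lengths in quotients of free groups -/

section WordLength

variable {α Γ : Type*} [DecidableEq α] [Group Γ] {π : FreeGroup α →* Γ}

lemma wlen_le_norm (π : FreeGroup α →* Γ) (w : FreeGroup α) :
    wlen (Set.range fun a => π (of a)) (π w) ≤ w.norm := by
  refine Nat.sInf_le ⟨fun i => π (mk [w.toWord[i]]), fun i => ?_, ?_⟩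
  · change π (mk [w.toWord[i]]) ∈ _ ∨ (π (mk [w.toWord[i]]))⁻¹ ∈ _
    generalize w.toWord[i] = c
    obtain ⟨a, b⟩ := c
    cases b
    · exact Or.inr ⟨a, by rw [← map_inv]; rfl⟩
    · exact Or.inl ⟨a, rfl⟩
  · have h : (List.ofFn fun i : Fin w.norm => π (mk [w.toWord[i]])) =
        w.toWord.map fun c => π (mk [c]) := by
      refine List.ext_getElem (by simp [FreeGroup.norm]) fun n h₁ h₂ => by simp
    have h2 : ∀ L : List (α × Bool), (L.map fun c => π (mk [c])).prod = π (mk L) := by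
      intro L
      induction L with
      | nil => simp [← one_eq_mk]
      | cons c L ih => rw [List.map_cons, List.prod_cons, ih, ← map_mul, mul_mk]; rfl
    rw [h, h2, mk_toWord]

lemma exists_norm_le_wlen (hπ : Function.Surjective π) (g : Γ) :
    ∃ w, π w = g ∧ w.norm ≤ wlen (Set.range fun a => π (of a)) g := by
  have hlist : ∀ L : List Γ,
      (∀ x ∈ L, x ∈ (Set.range fun a => π (of a)) ∨ x⁻¹ ∈ Set.range fun a => π (of a)) →
      ∃ w, π w = L.prod ∧ w.norm ≤ L.length := by
    intro L hL
    induction L with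
    | nil => exact ⟨1, by simp⟩
    | cons x L ih =>
      obtain ⟨w, hw, hn⟩ := ih fun y hy => hL y (List.mem_cons_of_mem _ hy)
      have hx : ∃ v : FreeGroup α, π v = x ∧ v.norm ≤ 1 := by
        rcases hL x List.mem_cons_self with ⟨a, ha⟩ | ⟨a, ha⟩
        · exact ⟨of a, ha, (norm_of a).le⟩
        · refine ⟨(of a)⁻¹, by rw [map_inv]; exact inv_eq_iff_eq_inv.2 ha, ?_⟩
          rw [norm_inv_eq, norm_of]
      obtain ⟨v, hv, hvn⟩ := hx
      refine ⟨v * w, by rw [map_mul, hv, hw, List.prod_cons], ?_⟩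
      have := FreeGroup.norm_mul_le v w
      rw [List.length_cons]
      omega
  have hne : {n | ∃ f : Fin n → Γ, (∀ i, f i ∈ (Set.range fun a => π (of a)) ∨
      (f i)⁻¹ ∈ Set.range fun a => π (of a)) ∧ (List.ofFn f).prod = g}.Nonempty := by
    obtain ⟨w, rfl⟩ := hπ g
    rw [← mk_toWord (x := w), lift_unique π (f := fun a => π (of a)) (fun _ => rfl), lift_mk]
    refine ⟨_, (w.toWord.map fun x => cond x.2 (π (of x.1)) (π (of x.1))⁻¹).get, fun i => ?_,
      by rw [List.ofFn_get]⟩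
    obtain ⟨⟨a, b⟩, -, hab⟩ := List.mem_map.1 (List.get_mem
      (w.toWord.map fun x => cond x.2 (π (of x.1)) (π (of x.1))⁻¹) i)
    rw [← hab]
    cases b
    · exact Or.inr ⟨a, by simp⟩
    · exact Or.inl ⟨a, rfl⟩
  obtain ⟨f, hf, hprod⟩ := Nat.sInf_mem hne
  obtain ⟨w, hw, hn⟩ := hlist (List.ofFn f) fun x hx => by
    obtain ⟨i, rfl⟩ := (List.mem_ofFn' _ _).1 hx
    exact hf i
  exact ⟨w, hw.trans hprod, by rwa [List.length_ofFn] at hn⟩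

end WordLength

/-! ### Shortest laws of solvable groups of given derived length -/

/-- The least length of a nontrivial element of the `d`-th derived subgroup of the free group of
rank two. -/
noncomputable def derivedGirth (d : ℕ) : ℕ :=
  sInf {n | ∃ w ∈ derivedSeries (FreeGroup (Fin 2)) d, w ≠ 1 ∧ w.norm = n}

lemma exists_mem_derivedSeries_ne_one (d : ℕ) :
    ∃ w ∈ derivedSeries (FreeGroup (Fin 2)) d, w ≠ 1 := by
  induction d with
  | zero => exact ⟨of 0, Subgroup.mem_top _, of_ne_one 0⟩
  | succ d ih =>
    obtain ⟨w, hw, h1⟩ := ih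
    exact ⟨metabelianEnd w, metabelianEnd_mem hw, metabelianEnd_ne_one h1⟩

lemma exists_norm_eq_derivedGirth (d : ℕ) :
    ∃ w ∈ derivedSeries (FreeGroup (Fin 2)) d, w ≠ 1 ∧ w.norm = derivedGirth d := by
  obtain ⟨w, hw, h1⟩ := exists_mem_derivedSeries_ne_one d
  exact Nat.sInf_mem
    (s := {n | ∃ w ∈ derivedSeries (FreeGroup (Fin 2)) d, w ≠ 1 ∧ w.norm = n})
    ⟨w.norm, w, hw, h1, rfl⟩

lemma derivedGirth_le {d : ℕ} {w : FreeGroup (Fin 2)}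
    (hw : w ∈ derivedSeries (FreeGroup (Fin 2)) d) (h1 : w ≠ 1) : derivedGirth d ≤ w.norm :=
  Nat.sInf_le ⟨w, hw, h1, rfl⟩

lemma norm_metabelianEnd_le (w : FreeGroup (Fin 2)) : (metabelianEnd w).norm ≤ w.norm * 14 :=
  norm_lift_le norm_metabelianLaw w

lemma derivedGirth_succ_le (d : ℕ) : derivedGirth (d + 1) ≤ derivedGirth d * 14 := by
  obtain ⟨w, hw, h1, hn⟩ := exists_norm_eq_derivedGirth d
  rw [← hn]
  exact (derivedGirth_le (metabelianEnd_mem hw) (metabelianEnd_ne_one h1)).trans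
    (norm_metabelianEnd_le w)

lemma le_derivedGirth (d : ℕ) : d ≤ derivedGirth d := by
  obtain ⟨w, hw, h1, hn⟩ := exists_norm_eq_derivedGirth d
  exact hn ▸ le_norm_of_mem_derivedSeries d hw h1

/-- The least derived length for which the shortest laws have length at least `L`. -/
noncomputable def derivedLevel (L : ℕ) : ℕ := sInf {d | L ≤ derivedGirth d}

lemma le_derivedGirth_derivedLevel (L : ℕ) : L ≤ derivedGirth (derivedLevel L) :=
  Nat.sInf_mem (s := {d | L ≤ derivedGirth d}) ⟨L, le_derivedGirth L⟩

lemma derivedLevel_mono : Monotone derivedLevel := fun _ L' h =>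
  Nat.sInf_le (h.trans (le_derivedGirth_derivedLevel L'))

lemma derivedGirth_derivedLevel_le {L : ℕ} (hL : 1 ≤ L) :
    derivedGirth (derivedLevel L) ≤ L * 14 := by
  rcases h : derivedLevel L with _ | d
  · have h0 := derivedGirth_le (d := 0) (Subgroup.mem_top (of (0 : Fin 2))) (of_ne_one 0)
    rw [norm_of] at h0
    omega
  · have hd : derivedGirth d < L := by
      by_contra hle
      have : derivedLevel L ≤ d := Nat.sInf_le (not_lt.1 hle)
      omega
    have := derivedGirth_succ_le d
    omega

/-! ### A family of wreath products of free solvable groups -/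

/-- The homomorphism onto a three-generated subgroup of a product of wreath products by `ℤ` of
free solvable groups of rank two, with derived lengths prescribed by `D`. -/
def solvableWreathHom (D : ℕ → ℕ) : FreeGroup (Fin 3) →*
    (∀ k, (FreeGroup (Fin 2) ⧸ derivedSeries (FreeGroup (Fin 2)) (D k)) ≀ᵣ Multiplicative ℤ) :=
  MonoidHom.pi fun k => lift
    (wreathGen (QuotientGroup.mk (of 0)) (QuotientGroup.mk (of 1)) ((29 * k : ℕ) : ℤ))

lemma solvableWreathHom_coupledPair_ne_one {D : ℕ → ℕ} {k : ℕ} {w : FreeGroup (Fin 2)}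
    (hw : w ∉ derivedSeries (FreeGroup (Fin 2)) (D k)) :
    solvableWreathHom D (lift (coupledPair (29 * k)) w) ≠ 1 := by
  intro h
  have h1 := congrFun h k
  rw [solvableWreathHom, MonoidHom.pi_apply, Pi.one_apply, lift_wreathGen_coupledPair,
    (injective_iff_map_eq_one' _).1 (wreathSingle_injective _ 0)] at h1
  have h2 : lift ![QuotientGroup.mk (of 0), QuotientGroup.mk (of 1)] =
      QuotientGroup.mk' (derivedSeries (FreeGroup (Fin 2)) (D k)) := by
    ext1 i
    fin_cases i <;> simp
  rw [h2, QuotientGroup.mk'_apply, QuotientGroup.eq_one_iff] at h1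
  exact hw h1

lemma solvableWreathHom_metabelianEnd {D : ℕ → ℕ} (hD : Monotone D) {k : ℕ}
    {w : FreeGroup (Fin 2)} (hw : w ∈ derivedSeries (FreeGroup (Fin 2)) (D k))
    {v : Fin 2 → FreeGroup (Fin 3)} (hv : ∀ i, (v i).norm ≤ k) :
    solvableWreathHom D (lift v (metabelianEnd w)) = 1 := by
  funext j
  rw [solvableWreathHom, MonoidHom.pi_apply, Pi.one_apply]
  rcases le_or_gt j k with hj | hj
  · have hbot : derivedSeries (FreeGroup (Fin 2) ⧸ derivedSeries (FreeGroup (Fin 2)) (D j))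
        (D j) = ⊥ := by
      rw [← map_derivedSeries_eq (QuotientGroup.mk'_surjective _), Subgroup.map_eq_bot_iff,
        QuotientGroup.ker_mk']
    refine eq_one_of_mem_derivedSeries_wreath hbot ?_
    have h1 := derivedSeries_antitone _ (Nat.succ_le_succ (hD hj)) (metabelianEnd_mem hw)
    exact map_derivedSeries_le_derivedSeries _ _ (Subgroup.mem_map_of_mem _
      (map_derivedSeries_le_derivedSeries _ _ (Subgroup.mem_map_of_mem _ h1)))
  · have h : ((lift (wreathGen (QuotientGroup.mk (of 0)) (QuotientGroup.mk (of 1))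
        ((29 * j : ℕ) : ℤ)) : FreeGroup (Fin 3) →*
          (FreeGroup (Fin 2) ⧸ derivedSeries (FreeGroup (Fin 2)) (D j)) ≀ᵣ Multiplicative ℤ).comp
        (lift v)).comp metabelianEnd = 1 := by
      ext1 i
      rw [MonoidHom.comp_apply, MonoidHom.comp_apply, metabelianEnd, lift_apply_of,
        MonoidHom.one_apply]
      refine lift_wreathGen_eq_one_of_mem _ _ (map_derivedSeries_le_derivedSeries _ _
        (Subgroup.mem_map_of_mem _ (metabelianLaw_mem i))) ?_
      have h1 := norm_lift_le hv (metabelianLaw i)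
      have h2 := Nat.mul_le_mul_right k (norm_metabelianLaw i)
      omega
    exact DFunLike.congr_fun h w

lemma norm_coupledPair_le (n : ℕ) :
    (coupledPair n 0).norm + (coupledPair n 1).norm ≤ 2 * n + 2 := by
  have h0 : (coupledPair n 0).norm = 1 := norm_of _
  have h1 : (coupledPair n 1).norm ≤ n + 1 + n := by
    have ha := FreeGroup.norm_mul_le ((of 0 ^ n)⁻¹ * of 2) (of 0 ^ n : FreeGroup (Fin 3))
    have hb := FreeGroup.norm_mul_le (of 0 ^ n)⁻¹ (of 2 : FreeGroup (Fin 3))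
    rw [norm_inv_eq, norm_of_pow, norm_of] at hb
    rw [norm_of_pow] at ha
    exact ha.trans (Nat.add_le_add_right hb n)
  omega

section Growth

variable {Γ : Type*} [Group Γ] {S : Set Γ}

lemma lt_chi (hΓ : IsLawless Γ) {w : FreeGroup (Fin 2)} (hw : w ≠ 1) {r : ℕ}
    (h : ∀ g : Fin 2 → Γ, (∀ i, wlen S (g i) ≤ r) → lift g w = 1) : r < chi S w := by
  obtain ⟨g₀, hg₀⟩ := not_forall.1 (hΓ 2 w hw)
  obtain ⟨g, hg, hc⟩ := Nat.sInf_mem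
    (s := {c | ∃ g : Fin 2 → Γ, lift g w ≠ 1 ∧ c = ∑ i, wlen S (g i)}) ⟨_, g₀, hg₀, rfl⟩
  by_contra hle
  refine hg (h g fun i => ?_)
  have h1 := Finset.single_le_sum (f := fun i => wlen S (g i)) (fun i _ => Nat.zero_le _)
    (Finset.mem_univ i)
  exact h1.trans (hc.symm.le.trans (not_lt.1 hle))

lemma lawGrowth_le {l b : ℕ}
    (h : ∀ w : FreeGroup (Fin 2), w ≠ 1 → w.norm ≤ l → chi S w ≤ b) : lawGrowth S l ≤ b := by
  refine csSup_le' ?_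
  rintro _ ⟨w, hw, hl, rfl⟩
  exact h w hw hl

lemma chi_le_lawGrowth {l b : ℕ}
    (h : ∀ w : FreeGroup (Fin 2), w ≠ 1 → w.norm ≤ l → chi S w ≤ b)
    {w : FreeGroup (Fin 2)} (hw : w ≠ 1) (hl : w.norm ≤ l) : chi S w ≤ lawGrowth S l := by
  refine le_csSup ⟨b, ?_⟩ ⟨w, hw, hl, rfl⟩
  rintro _ ⟨v, hv, hvl, rfl⟩
  exact h v hv hvl

end Growth

/-- Every function that is unbounded and nondecreasing on the positive integers is equivalent to
the lawlessness growth function of some finitely generated lawless group. -/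
theorem exists_lawGrowth_equiv (f : ℕ → ℕ) (hmono : ∀ ⦃m n : ℕ⦄, 1 ≤ m → m ≤ n → f m ≤ f n)
    (hunb : ∀ N : ℕ, ∃ n : ℕ, 1 ≤ n ∧ N ≤ f n) :
    ∃ (Γ : Type) (_ : Group Γ) (S : Set Γ),
      S.Finite ∧ Subgroup.closure S = ⊤ ∧ IsLawless Γ ∧ EquivGrowth (lawGrowth S) f := by
  classical
  let G : ℕ → ℕ := fun k => sInf {l | 1 ≤ l ∧ k ≤ f l}
  have hG : ∀ k, 1 ≤ G k ∧ k ≤ f (G k) := fun k => Nat.sInf_mem (hunb k)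
  have hGle : ∀ {k l}, 1 ≤ l → k ≤ f l → G k ≤ l := fun h1 h2 => Nat.sInf_le ⟨h1, h2⟩
  let D : ℕ → ℕ := fun k => derivedLevel (G k)
  have hD : Monotone D := fun k k' h =>
    derivedLevel_mono (hGle (hG k').1 (h.trans (hG k').2))
  let Φ := solvableWreathHom D
  let π : FreeGroup (Fin 3) →* Φ.range := Φ.rangeRestrict
  have hπ : Function.Surjective π := Φ.rangeRestrict_surjective
  have hπ1 : ∀ w, π w = 1 ↔ Φ w = 1 := fun w => Subtype.ext_iff
  let S : Set Φ.range := Set.range fun i => π (of i)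
  have hwit : ∀ l w, 1 ≤ l → w ≠ 1 → FreeGroup.norm w ≤ l →
      lift (fun i => π (coupledPair (29 * (f l + 1)) i)) w ≠ 1 := by
    intro l w hl hw hwl h
    have hlt : l < G (f l + 1) := by
      by_contra hle
      have := hmono (hG (f l + 1)).1 (not_lt.1 hle)
      have := (hG (f l + 1)).2
      omega
    have hmem : w ∉ derivedSeries (FreeGroup (Fin 2)) (D (f l + 1)) := fun hmem => by
      have h1 := derivedGirth_le hmem hw
      have h2 := le_derivedGirth_derivedLevel (G (f l + 1))
      have h3 : l < w.norm := hlt.trans_le (h2.trans h1)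
      omega
    refine solvableWreathHom_coupledPair_ne_one hmem ((hπ1 _).1 ?_)
    rw [← h]
    exact lift_unique (π.comp (lift (coupledPair (29 * (f l + 1))))) (fun i => by simp)
  have hlawless : IsLawless Φ.range := by
    intro k w hw hlaw
    obtain ⟨ψ, hψ⟩ := exists_injective_freeGroup_fin_two k
    have hw' : ψ w ≠ 1 := fun h => hw (hψ (h.trans ψ.map_one.symm))
    have h1 := hwit ((ψ w).norm + 1) (ψ w) (by omega) hw' (by omega)
    apply h1
    rw [← hlaw fun i => lift (fun i => π (coupledPair (29 * (f ((ψ w).norm + 1) + 1)) i))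
      (ψ (of i))]
    exact lift_unique ((lift fun i => π (coupledPair (29 * (f ((ψ w).norm + 1) + 1)) i)).comp ψ)
      (fun i => rfl)
  have hchi : ∀ l, 1 ≤ l → ∀ w : FreeGroup (Fin 2), w ≠ 1 → w.norm ≤ l →
      chi S w ≤ 58 * f l + 60 := by
    intro l hl w hw hwl
    have h1 : chi S w ≤ ∑ i, wlen S (π (coupledPair (29 * (f l + 1)) i)) :=
      Nat.sInf_le ⟨_, hwit l w hl hw hwl, rfl⟩
    rw [Fin.sum_univ_two] at h1
    have h2 := wlen_le_norm π (coupledPair (29 * (f l + 1)) 0)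
    have h3 := wlen_le_norm π (coupledPair (29 * (f l + 1)) 1)
    have h4 := norm_coupledPair_le (29 * (f l + 1))
    have h5 := add_le_add h2 h3
    have h6 : chi S w ≤ 2 * (29 * (f l + 1)) + 2 := h1.trans (h5.trans h4)
    omega
  refine ⟨Φ.range, inferInstance, S, Set.finite_range _, ?_, hlawless, ?_, ?_⟩
  · have h : S = π '' Set.range of := by rw [← Set.range_comp]; rfl
    rw [h, ← MonoidHom.map_closure, closure_range_of, ← MonoidHom.range_eq_map,
      MonoidHom.range_eq_top.2 hπ]
  · obtain ⟨l₀, hl₀, hfl₀⟩ := hunb 1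
    refine ⟨118 + l₀, by omega, fun l hl => ?_⟩
    refine (lawGrowth_le (hchi l hl)).trans ?_
    have h1 : f l ≤ f ((118 + l₀) * l) := hmono hl (Nat.le_mul_of_pos_left l (by omega))
    have h2 : 1 ≤ f ((118 + l₀) * l) := hfl₀.trans (hmono hl₀ (by nlinarith))
    nlinarith [Nat.zero_le (l₀ * f ((118 + l₀) * l))]
  · refine ⟨196, by norm_num, fun l hl => ?_⟩
    obtain ⟨w, hw, hw1, hn⟩ := exists_norm_eq_derivedGirth (D (f l))
    have hnorm : (metabelianEnd w).norm ≤ 196 * l := by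
      have h1 := norm_metabelianEnd_le w
      have h2 : derivedGirth (D (f l)) ≤ G (f l) * 14 := derivedGirth_derivedLevel_le (hG _).1
      have h3 := hGle hl (le_refl (f l))
      omega
    have hlt : f l < chi S (metabelianEnd w) := by
      refine lt_chi hlawless (metabelianEnd_ne_one hw1) fun g hg => ?_
      choose v hv hvn using fun i => exists_norm_le_wlen hπ (g i)
      have h1 := (hπ1 _).2 (solvableWreathHom_metabelianEnd hD hw
        fun i => (hvn i).trans (hg i))
      rw [← h1]
      exact (lift_unique (π.comp (lift v)) (fun i => by simp [hv])).symm
    have h2 := chi_le_lawGrowth (hchi (196 * l) (by omega)) (metabelianEnd_ne_one hw1) hnorm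
    omega

end LawlessnessGrowth

/-- Suppose `f` is unbounded and nondecreasing, `g` satisfies `f(g(n)) = n`
for all `n`, and `g(Mn) ≥ 93·g(n)` for some constant `M` and all `n`. Then there is a lawless
group `Γ` generated by a finite set `S` with `𝒜_Γ^S ≈ f`. -/
theorem stmt2 (f : ℕ → ℕ)
    (hmono : ∀ ⦃m n : ℕ⦄, 1 ≤ m → m ≤ n → f m ≤ f n)
    (hunb : ∀ N : ℕ, ∃ n : ℕ, 1 ≤ n ∧ N ≤ f n)
    (g : ℕ → ℕ) (hfg : ∀ n : ℕ, 1 ≤ n → f (g n) = n)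
    (hM : ∃ M : ℕ, 1 ≤ M ∧ ∀ n : ℕ, 1 ≤ n → 93 * g n ≤ g (M * n)) :
    ∃ (Γ : Type) (_ : Group Γ) (S : Set Γ),
      S.Finite ∧ Subgroup.closure S = ⊤ ∧ IsLawless Γ ∧ EquivGrowth (lawGrowth S) f := by
  exact exists_lawGrowth_equiv f hmono hunb
end

section
/- Let f : ℕ → ℕ be an unbounded nondecreasing function, and suppose there exists M ∈ ℕ with M ≥ 2 such that f(Mn) ≥ M·f(n) for all n ∈ ℕ. Then there exists a lawless group Γ generated by a finite set S such that 𝒜_Γ^S ≈ f. -/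
/-! ### Free groups -/

open scoped commutatorElement

namespace FreeGroup

/-- The commutator of the two generators of the free group of rank two, or of their inverses,
or the inverse of one of these two, as a reduced word. -/
def commWord : Fin 2 × Bool → List (Fin 2 × Bool)
  | (0, true) => [(0, true), (1, true), (0, false), (1, false)]
  | (0, false) => [(1, true), (0, true), (1, false), (0, false)]
  | (1, true) => [(0, false), (1, false), (0, true), (1, true)]
  | (1, false) => [(1, false), (0, false), (1, true), (0, true)]

/-- The endomorphism of the free group of rank two sending the generators `x`, `y` to
`⁅x, y⁆` and `⁅x⁻¹, y⁻¹⁆`. -/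
def commHom : FreeGroup (Fin 2) →* FreeGroup (Fin 2) :=
  lift ![⁅of (0 : Fin 2), of (1 : Fin 2)⁆, ⁅(of (0 : Fin 2))⁻¹, (of (1 : Fin 2))⁻¹⁆]

theorem commHom_mk (L : List (Fin 2 × Bool)) :
    commHom (mk L) = mk (L.flatMap commWord) := by
  induction L with
  | nil => rfl
  | cons p L ih =>
    have hp : commHom (mk [p]) = mk (commWord p) := by
      match p with
      | (0, true) | (0, false) | (1, true) | (1, false) => rfl
    rw [← List.singleton_append, ← mul_mk, _root_.map_mul, ih, hp, mul_mk]
    rfl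

theorem isReduced_flatMap_commWord {L : List (Fin 2 × Bool)} (hL : IsReduced L) :
    IsReduced (L.flatMap commWord) := by
  rw [IsReduced, List.flatMap, List.isChain_flatten]
  · refine ⟨?_, ?_⟩
    · simp only [List.mem_map, forall_exists_index, and_imp]
      rintro _ p - rfl
      revert p
      decide
    · rw [List.isChain_map]
      refine List.IsChain.imp ?_ hL
      decide
  · simp only [List.mem_map, not_exists, not_and]
    rintro p -
    revert p
    decide

theorem length_toWord_commHom (w : FreeGroup (Fin 2)) :
    (commHom w).toWord.length = 4 * w.toWord.length := by
  conv_lhs => rw [← mk_toWord (x := w)]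
  rw [commHom_mk, toWord_mk, (isReduced_flatMap_commWord isReduced_toWord).reduce_eq,
    List.length_flatMap]
  have h : ∀ p, (commWord p).length = 4 := by decide
  simp [h, mul_comm]

theorem commHom_ne_one {w : FreeGroup (Fin 2)} (hw : w ≠ 1) : commHom w ≠ 1 := by
  rw [Ne, ← toWord_eq_nil_iff, ← List.length_eq_zero_iff] at hw ⊢
  rw [length_toWord_commHom]
  omega

theorem commHom_mem_derivedSeries {w : FreeGroup (Fin 2)} {c : ℕ}
    (hw : w ∈ derivedSeries (FreeGroup (Fin 2)) c) :
    commHom w ∈ derivedSeries (FreeGroup (Fin 2)) (c + 1) := by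
  suffices h : (derivedSeries (FreeGroup (Fin 2)) c).map commHom ≤ derivedSeries _ (c + 1) from
    h ⟨w, hw, rfl⟩
  clear hw
  induction c with
  | zero =>
    rw [derivedSeries_succ, derivedSeries_zero, ← MonoidHom.range_eq_map, commHom]
    refine range_lift_le ?_
    rintro _ ⟨i, rfl⟩
    fin_cases i <;> exact Subgroup.commutator_mem_commutator trivial trivial
  | succ c ih =>
    rw [derivedSeries_succ, Subgroup.map_commutator, derivedSeries_succ _ (c + 1)]
    exact Subgroup.commutator_mono ih ih

theorem toWord_mk_singleton_mul {α : Type*} [DecidableEq α] {g : FreeGroup α} {a : α} {b : Bool}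
    (h : g.toWord.head? ≠ some (a, !b)) : (mk [(a, b)] * g).toWord = (a, b) :: g.toWord := by
  have hred : IsReduced ((a, b) :: g.toWord) := by
    rw [IsReduced, List.isChain_cons]
    refine ⟨?_, isReduced_toWord⟩
    rintro ⟨a', b'⟩ hg rfl
    rw [Option.mem_def] at hg
    rw [hg] at h
    cases b <;> cases b' <;> simp_all
  calc (mk [(a, b)] * g).toWord = (mk [(a, b)] * mk g.toWord).toWord := by rw [mk_toWord]
    _ = (a, b) :: g.toWord := by rw [mul_mk, toWord_mk, List.singleton_append, hred.reduce_eq]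

theorem head?_toWord_of_pow_mul {α : Type*} [DecidableEq α] {g : FreeGroup α} {a : α}
    (h : g.toWord.head? ≠ some (a, false)) (n : ℕ) :
    (of a ^ (n + 1) * g).toWord.head? = some (a, true) := by
  induction n with
  | zero =>
    rw [zero_add, pow_one]
    change (mk [(a, true)] * g).toWord.head? = _
    rw [toWord_mk_singleton_mul (by simpa using h), List.head?_cons]
  | succ n ih =>
    rw [pow_succ', mul_assoc]
    change (mk [(a, true)] * _).toWord.head? = _
    rw [toWord_mk_singleton_mul (by simp [ih]), List.head?_cons]

/-- The elements `xⁱ y x⁻ⁱ` of a free group of rank two generate a free group. -/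
theorem injective_lift_conj (k : ℕ) :
    Function.Injective (lift fun i : Fin (k + 2) =>
      of (0 : Fin 2) ^ (i : ℕ) * of 1 * (of 0 ^ (i : ℕ))⁻¹) := by
  have key (i j : ℕ) (b c : Bool) (g : FreeGroup (Fin 2))
      (hi : ((of 0 ^ i)⁻¹ * g).toWord.head? = some (1, b))
      (hj : ((of 0 ^ j)⁻¹ * g).toWord.head? = some (1, c)) : i = j ∧ b = c := by
    have aux (i j : ℕ) (b c : Bool)
        (hi : ((of 0 ^ i)⁻¹ * g).toWord.head? = some (1, b))
        (hj : ((of 0 ^ j)⁻¹ * g).toWord.head? = some (1, c)) : ¬ i < j := by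
      intro hij
      obtain ⟨n, rfl⟩ := Nat.exists_eq_add_of_lt hij
      have h := head?_toWord_of_pow_mul (g := (of 0 ^ (i + n + 1))⁻¹ * g) (a := (0 : Fin 2))
        (by simp [hj]) n
      rw [show of (0 : Fin 2) ^ (n + 1) * ((of 0 ^ (i + n + 1))⁻¹ * g) = (of 0 ^ i)⁻¹ * g by
        rw [add_assoc, pow_add]; group, hi] at h
      simp at h
    have hij : i = j := le_antisymm (not_lt.1 (aux j i c b hj hi)) (not_lt.1 (aux i j b c hi hj))
    subst hij
    simpa [hi] using hj
  refine injective_lift_of_ping_pong (α := FreeGroup (Fin 2)) _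
    (fun i => {g | ((of 0 ^ (i : ℕ))⁻¹ * g).toWord.head? = some (1, true)})
    (fun i => {g | ((of 0 ^ (i : ℕ))⁻¹ * g).toWord.head? = some (1, false)}) ?_ ?_ ?_ ?_ ?_ ?_
  · exact fun i => ⟨of 0 ^ (i : ℕ) * of 1, by simp⟩
  · exact fun i j hij => Set.disjoint_left.2 fun g hi hj =>
      hij (Fin.ext (key i j true true g hi hj).1)
  · exact fun i j hij => Set.disjoint_left.2 fun g hi hj =>
      hij (Fin.ext (key i j false false g hi hj).1)
  · exact fun i j => Set.disjoint_left.2 fun g hi hj =>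
      absurd (key i j true false g hi hj).2 (by simp)
  · rintro i _ ⟨g, hg, rfl⟩
    rw [Set.mem_compl_iff, Set.mem_ofPred_eq] at hg
    simp only [smul_eq_mul, Set.mem_ofPred_eq, mul_assoc, inv_mul_cancel_left]
    change (mk [((1 : Fin 2), true)] * _).toWord.head? = _
    rw [toWord_mk_singleton_mul (by simpa using hg), List.head?_cons]
  · rintro i _ ⟨g, hg, rfl⟩
    rw [Set.mem_compl_iff, Set.mem_ofPred_eq] at hg
    simp only [smul_eq_mul, Set.mem_ofPred_eq, mul_assoc, inv_mul_cancel_left, Pi.inv_apply,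
      mul_inv_rev, inv_inv]
    change (mk [((1 : Fin 2), false)] * _).toWord.head? = _
    rw [toWord_mk_singleton_mul (by simpa using hg), List.head?_cons]

open scoped MatrixGroups
open CongruenceSubgroup

/-- The upper triangular generator of the image of `sanovHom`. -/
def sanovUpper : SL(2, ℤ) := ⟨!![1, 3; 0, 1], by simp⟩

/-- The lower triangular generator of the image of `sanovHom`. -/
def sanovLower : SL(2, ℤ) := ⟨!![1, 0; 3, 1], by simp⟩

/-- The representation of the free group of rank two by the matrices `!![1, 3; 0, 1]` and
`!![1, 0; 3, 1]`. -/
def sanovHom : FreeGroup (Fin 2) →* SL(2, ℤ) :=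
  lift ![sanovUpper, sanovLower]

/-- The vectors in whose direction the image of a letter under `sanovHom` attracts. -/
def IsAttracted : Fin 2 × Bool → ℤ × ℤ → Prop
  | (0, true), v => |v.2| < |v.1| ∧ 0 < v.1 * v.2
  | (0, false), v => |v.2| < |v.1| ∧ v.1 * v.2 < 0
  | (1, true), v => |v.1| < |v.2| ∧ 0 < v.1 * v.2
  | (1, false), v => |v.1| < |v.2| ∧ v.1 * v.2 < 0

/-- The action on vectors of the image of a letter under `sanovHom`. -/
def letterAct : Fin 2 × Bool → ℤ × ℤ → ℤ × ℤ
  | (0, true), v => (v.1 + 3 * v.2, v.2)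
  | (0, false), v => (v.1 - 3 * v.2, v.2)
  | (1, true), v => (v.1, v.2 + 3 * v.1)
  | (1, false), v => (v.1, v.2 - 3 * v.1)

theorem sanovHom_mulVec (l : Fin 2 × Bool) (v : ℤ × ℤ) :
    (sanovHom (mk [l])).1.mulVec ![v.1, v.2] = ![(letterAct l v).1, (letterAct l v).2] := by
  have h0 : sanovHom (of 0) = sanovUpper := lift_apply_of ..
  have h1 : sanovHom (of 1) = sanovLower := lift_apply_of ..
  have hX : sanovUpper.1 = !![1, 3; 0, 1] := rfl
  have hY : sanovLower.1 = !![1, 0; 3, 1] := rfl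
  match l with
  | (0, true) =>
    rw [show sanovHom (mk [((0 : Fin 2), true)]) = sanovUpper from h0, hX]
    ext j
    fin_cases j <;> simp [letterAct, Matrix.mulVec, dotProduct]
  | (1, true) =>
    rw [show sanovHom (mk [((1 : Fin 2), true)]) = sanovLower from h1, hY]
    ext j
    fin_cases j <;> simp [letterAct, Matrix.mulVec, dotProduct, add_comm]
  | (0, false) =>
    rw [show mk [((0 : Fin 2), false)] = (of 0)⁻¹ from rfl, _root_.map_inv, h0,
      Matrix.SpecialLinearGroup.coe_inv, hX, Matrix.adjugate_fin_two_of]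
    ext j
    fin_cases j <;> simp [letterAct, Matrix.mulVec, dotProduct]
    ring
  | (1, false) =>
    rw [show mk [((1 : Fin 2), false)] = (of 1)⁻¹ from rfl, _root_.map_inv, h1,
      Matrix.SpecialLinearGroup.coe_inv, hY, Matrix.adjugate_fin_two_of]
    ext j
    fin_cases j <;> simp [letterAct, Matrix.mulVec, dotProduct]
    ring

theorem isAttracted_letterAct {l l' : Fin 2 × Bool} (h : l.1 = l'.1 → l.2 = l'.2) {v : ℤ × ℤ}
    (hv : IsAttracted l' v) : IsAttracted l (letterAct l v) := by
  obtain ⟨p, q⟩ := v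
  match l, l' with
  | (0, true), (0, true) | (0, true), (1, true) | (0, true), (1, false)
  | (0, false), (0, false) | (0, false), (1, true) | (0, false), (1, false)
  | (1, true), (1, true) | (1, true), (0, true) | (1, true), (0, false)
  | (1, false), (1, false) | (1, false), (0, true) | (1, false), (0, false) =>
    simp only [IsAttracted, letterAct, ← sq_lt_sq] at hv ⊢
    constructor <;> nlinarith [sq_nonneg p, sq_nonneg q]
  | (0, true), (0, false) | (0, false), (0, true) | (1, true), (1, false)
  | (1, false), (1, true) => simp at h

theorem isAttracted_sanovHom (l : Fin 2 × Bool) (L : List (Fin 2 × Bool))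
    (hL : IsReduced (l :: L)) :
    ∃ v : ℤ × ℤ, (sanovHom (mk (l :: L))).1.mulVec ![1, 1] = ![v.1, v.2] ∧ IsAttracted l v := by
  induction L generalizing l with
  | nil =>
    refine ⟨letterAct l (1, 1), sanovHom_mulVec l (1, 1), ?_⟩
    match l with
    | (0, true) | (0, false) | (1, true) | (1, false) => simp [IsAttracted, letterAct]
  | cons l' L ih =>
    rw [IsReduced, List.isChain_cons_cons] at hL
    obtain ⟨v, hv, hv'⟩ := ih l' hL.2
    refine ⟨letterAct l v, ?_, isAttracted_letterAct hL.1 hv'⟩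
    rw [← sanovHom_mulVec, ← hv, Matrix.mulVec_mulVec, ← Matrix.SpecialLinearGroup.coe_mul,
      ← _root_.map_mul, mul_mk, List.singleton_append]

theorem sanovHom_injective : Function.Injective sanovHom := by
  rw [injective_iff_map_eq_one]
  intro w hw
  rw [← toWord_eq_nil_iff]
  by_contra hne
  obtain ⟨l, L, hL⟩ := List.exists_cons_of_ne_nil hne
  obtain ⟨⟨p, q⟩, hv, hv'⟩ := isAttracted_sanovHom l L (hL ▸ isReduced_toWord)
  rw [← hL, mk_toWord, hw, Matrix.SpecialLinearGroup.coe_one, Matrix.one_mulVec] at hv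
  obtain rfl : 1 = p := congrFun hv 0
  obtain rfl : 1 = q := congrFun hv 1
  obtain ⟨i, b⟩ := l
  fin_cases i <;> cases b <;> simp [IsAttracted] at hv'

theorem mem_Gamma_iff_dvd {N : ℕ} {A : SL(2, ℤ)} :
    A ∈ Gamma N ↔ (N : ℤ) ∣ A 0 0 - 1 ∧ (N : ℤ) ∣ A 0 1 ∧ (N : ℤ) ∣ A 1 0 ∧
      (N : ℤ) ∣ A 1 1 - 1 := by
  simp only [Gamma_mem, ← ZMod.intCast_zmod_eq_zero_iff_dvd, Int.cast_sub, Int.cast_one,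
    sub_eq_zero]

theorem commutator_Gamma_le {M N : ℕ} (h : M ∣ N ^ 2) : ⁅Gamma N, Gamma N⁆ ≤ Gamma M := by
  rw [Subgroup.commutator_le]
  intro A hA B hB
  rw [Gamma_mem', map_commutatorElement, commutatorElement_eq_one_iff_mul_comm,
    ← _root_.map_mul, ← _root_.map_mul]
  rw [mem_Gamma_iff_dvd] at hA hB
  obtain ⟨⟨a, ha⟩, ⟨b, hb⟩, ⟨c, hc⟩, ⟨d, hd⟩⟩ := hA
  obtain ⟨⟨a', ha'⟩, ⟨b', hb'⟩, ⟨c', hc'⟩, ⟨d', hd'⟩⟩ := hB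
  obtain ⟨m, hm⟩ := h
  have hm' : (N : ℤ) ^ 2 = M * m := by exact_mod_cast hm
  rw [sub_eq_iff_eq_add] at ha hd ha' hd'
  ext i j
  simp only [Matrix.SpecialLinearGroup.map_apply_coe, RingHom.mapMatrix_apply, Matrix.map_apply,
    Int.coe_castRingHom]
  rw [ZMod.intCast_eq_intCast_iff_dvd_sub, Matrix.SpecialLinearGroup.coe_mul,
    Matrix.SpecialLinearGroup.coe_mul, Matrix.mul_apply, Matrix.mul_apply, Fin.sum_univ_two,
    Fin.sum_univ_two]
  fin_cases i <;> fin_cases j <;>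
    simp only [Fin.zero_eta, Fin.mk_one, ha, hb, hc, hd, ha', hb', hc', hd']
  · exact ⟨m * (b' * c - b * c'), by linear_combination (b' * c - b * c') * hm'⟩
  · exact ⟨m * (a' * b + b' * d - a * b' - b * d'), by
      linear_combination (a' * b + b' * d - a * b' - b * d') * hm'⟩
  · exact ⟨m * (c' * a + d' * c - c * a' - d * c'), by
      linear_combination (c' * a + d' * c - c * a' - d * c') * hm'⟩
  · exact ⟨m * (c' * b - c * b'), by linear_combination (c' * b - c * b') * hm'⟩

theorem map_derivedSeries_sanovHom_le (c : ℕ) :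
    (derivedSeries (FreeGroup (Fin 2)) c).map sanovHom ≤ Gamma (3 ^ (c + 1)) := by
  induction c with
  | zero =>
    rw [derivedSeries_zero, ← MonoidHom.range_eq_map, sanovHom]
    refine range_lift_le ?_
    rintro _ ⟨i, rfl⟩
    fin_cases i <;> simp only [SetLike.mem_coe, mem_Gamma_iff_dvd] <;>
      simp [sanovUpper, sanovLower]
  | succ c ih =>
    rw [derivedSeries_succ, Subgroup.map_commutator]
    refine (Subgroup.commutator_mono ih ih).trans (commutator_Gamma_le ?_)
    rw [← pow_mul]
    exact pow_dvd_pow _ (by omega)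

theorem exists_notMem_derivedSeries {w : FreeGroup (Fin 2)} (hw : w ≠ 1) :
    ∃ c, w ∉ derivedSeries (FreeGroup (Fin 2)) c := by
  by_contra! h
  refine hw (sanovHom_injective ?_)
  have hmem (c : ℕ) := mem_Gamma_iff_dvd.1 (map_derivedSeries_sanovHom_le c ⟨w, h c, rfl⟩)
  have key (z : ℤ) (hz : ∀ c : ℕ, ((3 ^ (c + 1) : ℕ) : ℤ) ∣ z) : z = 0 := by
    refine Int.eq_zero_of_abs_lt_dvd (hz z.natAbs) ?_
    rw [Int.abs_eq_natAbs]
    exact_mod_cast (Nat.lt_succ_self _).trans (Nat.lt_pow_self (by norm_num))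
  rw [_root_.map_one]
  ext i j
  fin_cases i <;> fin_cases j
  · simpa [sub_eq_zero] using key _ fun c => (hmem c).1
  · simpa using key _ fun c => (hmem c).2.1
  · simpa using key _ fun c => (hmem c).2.2.1
  · simpa [sub_eq_zero] using key _ fun c => (hmem c).2.2.2

end FreeGroup

/-! ### Words in the generators -/

section Words

variable {G H : Type*} [Group G] [Group H]

/-- `g` is a product of `n` elements of `S ∪ S⁻¹`. -/
def HasWord (S : Set G) (n : ℕ) (g : G) : Prop :=
  ∃ L : List G, L.length = n ∧ (∀ x ∈ L, x ∈ S ∨ x⁻¹ ∈ S) ∧ L.prod = g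

theorem HasWord.mul {S : Set G} {m n : ℕ} {g h : G} (hg : HasWord S m g) (hh : HasWord S n h) :
    HasWord S (m + n) (g * h) := by
  obtain ⟨L, rfl, hL, rfl⟩ := hg
  obtain ⟨L', rfl, hL', rfl⟩ := hh
  refine ⟨L ++ L', List.length_append, fun x hx => ?_, List.prod_append⟩
  exact (List.mem_append.1 hx).elim (hL x) (hL' x)

theorem HasWord.inv {S : Set G} {n : ℕ} {g : G} (hg : HasWord S n g) : HasWord S n g⁻¹ := by
  obtain ⟨L, rfl, hL, rfl⟩ := hg
  refine ⟨(L.map Inv.inv).reverse, by simp, fun x hx => ?_, (List.prod_inv_reverse L).symm⟩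
  obtain ⟨y, hy, rfl⟩ := List.mem_map.1 (List.mem_reverse.1 hx)
  rw [inv_inv]
  exact (hL y hy).symm

theorem HasWord.commutator {S : Set G} {m n : ℕ} {g h : G} (hg : HasWord S m g)
    (hh : HasWord S n h) : HasWord S (2 * (m + n)) ⁅g, h⁆ := by
  have := ((hg.mul hh).mul hg.inv).mul hh.inv
  rwa [show m + n + m + n = 2 * (m + n) by ring] at this

theorem HasWord.of_mem {S : Set G} {g : G} (hg : g ∈ S) : HasWord S 1 g :=
  ⟨[g], rfl, by simp [hg], List.prod_singleton⟩

theorem HasWord.pow {S : Set G} {g : G} (hg : g ∈ S) (n : ℕ) : HasWord S n (g ^ n) :=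
  ⟨List.replicate n g, List.length_replicate, fun x hx => by simp [List.eq_of_mem_replicate hx, hg],
    List.prod_replicate n g⟩

theorem HasWord.map {S : Set G} {T : Set H} {n : ℕ} {g : G} (hg : HasWord S n g) (φ : G →* H)
    (hφ : ∀ x ∈ S, φ x ∈ T) : HasWord T n (φ g) := by
  obtain ⟨L, rfl, hL, rfl⟩ := hg
  refine ⟨L.map φ, by simp, fun x hx => ?_, (map_list_prod φ L).symm⟩
  obtain ⟨y, hy, rfl⟩ := List.mem_map.1 hx
  rw [← map_inv]
  exact (hL y hy).imp (hφ y) (hφ _)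

theorem wlen_le {S : Set G} {n : ℕ} {g : G} (hg : HasWord S n g) : wlen S g ≤ n := by
  obtain ⟨L, rfl, hL, rfl⟩ := hg
  exact Nat.sInf_le ⟨L.get, fun i => hL _ (L.get_mem i), by rw [List.ofFn_get]⟩

theorem hasWord_wlen {S : Set G} (hS : Subgroup.closure S = ⊤) (g : G) :
    HasWord S (wlen S g) g := by
  obtain ⟨L, hL, hLg⟩ : ∃ L : List G, (∀ x ∈ L, x ∈ S ∪ S⁻¹) ∧ L.prod = g := by
    refine Submonoid.exists_list_of_mem_closure ?_
    rw [← Subgroup.closure_toSubmonoid, hS]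
    exact Submonoid.mem_top g
  obtain ⟨f, hf, hfg⟩ : wlen S g ∈ {n | ∃ f : Fin n → G, (∀ i, f i ∈ S ∨ (f i)⁻¹ ∈ S) ∧
      (List.ofFn f).prod = g} :=
    Nat.sInf_mem ⟨L.length, L.get, fun i => hL _ (L.get_mem i), by rw [List.ofFn_get, hLg]⟩
  refine ⟨List.ofFn f, List.length_ofFn, fun x hx => ?_, hfg⟩
  obtain ⟨i, rfl⟩ := List.mem_ofFn.1 hx
  exact hf i

theorem map_lift_apply {α : Type*} (φ : G →* H) (g : α → G) (w : FreeGroup α) :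
    φ (FreeGroup.lift g w) = FreeGroup.lift (φ ∘ g) w := by
  induction w using FreeGroup.induction_on <;> simp_all

theorem lift_commHom (g : Fin 2 → G) (w : FreeGroup (Fin 2)) :
    FreeGroup.lift g (FreeGroup.commHom w) =
      FreeGroup.lift ![⁅g 0, g 1⁆, ⁅(g 0)⁻¹, (g 1)⁻¹⁆] w := by
  rw [FreeGroup.commHom, map_lift_apply]
  congr 2
  ext i
  fin_cases i <;> simp [commutatorElement_def]

theorem lift_eq_one_of_mem_zpowers {a b c : G} (ha : a ∈ Subgroup.zpowers c)
    (hb : b ∈ Subgroup.zpowers c) {w : FreeGroup (Fin 2)}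
    (hw : w ∈ derivedSeries (FreeGroup (Fin 2)) 1) : FreeGroup.lift ![a, b] w = 1 := by
  have hrange : (FreeGroup.lift ![a, b]).range ≤ Subgroup.zpowers c := by
    refine FreeGroup.range_lift_le ?_
    rintro _ ⟨i, rfl⟩
    fin_cases i
    exacts [ha, hb]
  suffices h : derivedSeries (FreeGroup (Fin 2)) 1 ≤ (FreeGroup.lift ![a, b]).ker from h hw
  rw [derivedSeries_one, commutator_def, Subgroup.commutator_le]
  intro p _ q _
  obtain ⟨m, hm⟩ := hrange ⟨p, rfl⟩
  obtain ⟨n, hn⟩ := hrange ⟨q, rfl⟩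
  rw [MonoidHom.mem_ker, map_commutatorElement, commutatorElement_eq_one_iff_commute, ← hm, ← hn]
  exact Commute.zpow_zpow_self c m n

end Words

/-! ### Shortest words in the derived series of the free group -/

section MinLen

/-- The length of the shortest nontrivial elements of the `k`-th derived subgroup of the free
group of rank two. -/
noncomputable def minLen (k : ℕ) : ℕ :=
  sInf {n | ∃ w ∈ derivedSeries (FreeGroup (Fin 2)) k, w ≠ 1 ∧ wordLen w = n}

theorem minLen_le {k : ℕ} {w : FreeGroup (Fin 2)} (hw : w ∈ derivedSeries (FreeGroup (Fin 2)) k)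
    (hw1 : w ≠ 1) : minLen k ≤ wordLen w :=
  Nat.sInf_le ⟨w, hw, hw1, rfl⟩

theorem exists_wordLen_eq_minLen (k : ℕ) :
    ∃ w ∈ derivedSeries (FreeGroup (Fin 2)) k, w ≠ 1 ∧ wordLen w = minLen k := by
  obtain ⟨w, hw, hw1⟩ : ∃ w ∈ derivedSeries (FreeGroup (Fin 2)) k, w ≠ 1 := by
    induction k with
    | zero => exact ⟨.of 0, Subgroup.mem_top _, FreeGroup.of_ne_one 0⟩
    | succ k ih =>
      obtain ⟨w, hw, hw1⟩ := ih
      exact ⟨_, FreeGroup.commHom_mem_derivedSeries hw, FreeGroup.commHom_ne_one hw1⟩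
  exact Nat.sInf_mem (s := {n | ∃ w ∈ derivedSeries (FreeGroup (Fin 2)) k, w ≠ 1 ∧ wordLen w = n})
    ⟨_, w, hw, hw1, rfl⟩

theorem one_le_minLen (k : ℕ) : 1 ≤ minLen k := by
  obtain ⟨w, -, hw1, hw⟩ := exists_wordLen_eq_minLen k
  rwa [← hw, wordLen, Nat.one_le_iff_ne_zero, Ne, List.length_eq_zero_iff,
    FreeGroup.toWord_eq_nil_iff]

theorem minLen_mono : Monotone minLen := by
  intro j k hjk
  obtain ⟨w, hw, hw1, hwk⟩ := exists_wordLen_eq_minLen k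
  exact hwk ▸ minLen_le (derivedSeries_antitone _ hjk hw) hw1

theorem minLen_zero : minLen 0 = 1 :=
  (one_le_minLen 0).antisymm' <| by
    simpa [wordLen] using minLen_le (Subgroup.mem_top _) (FreeGroup.of_ne_one (0 : Fin 2))

theorem minLen_succ_le (k : ℕ) : minLen (k + 1) ≤ 4 * minLen k := by
  obtain ⟨w, hw, hw1, hwk⟩ := exists_wordLen_eq_minLen k
  rw [← hwk, wordLen, ← FreeGroup.length_toWord_commHom]
  exact minLen_le (FreeGroup.commHom_mem_derivedSeries hw) (FreeGroup.commHom_ne_one hw1)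

theorem exists_lt_minLen (l : ℕ) : ∃ k, l < minLen k := by
  choose c hc using fun w : {w : FreeGroup (Fin 2) // w ≠ 1} =>
    FreeGroup.exists_notMem_derivedSeries w.2
  have hfin : {w : {w : FreeGroup (Fin 2) // w ≠ 1} | wordLen w.1 ≤ l}.Finite :=
    Set.Finite.preimage (FreeGroup.toWord_injective.comp Subtype.val_injective).injOn
      (List.finite_length_le (Fin 2 × Bool) l)
  obtain ⟨k, hk⟩ := (hfin.image c).bddAbove
  obtain ⟨w, hw, hw1, hwk⟩ := exists_wordLen_eq_minLen k
  refine ⟨k, lt_of_not_ge fun hkl => hc ⟨w, hw1⟩ (derivedSeries_antitone _ ?_ hw)⟩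
  exact hk ⟨⟨w, hw1⟩, hwk.trans_le hkl, rfl⟩

theorem exists_minLen_le_lt {l : ℕ} (hl : 1 ≤ l) : ∃ k, minLen k ≤ l ∧ l < minLen (k + 1) := by
  classical
  obtain ⟨k, hk⟩ := Nat.exists_eq_succ_of_ne_zero (n := Nat.find (exists_lt_minLen l)) <| by
    rw [Ne, Nat.find_eq_zero, minLen_zero]
    omega
  have hspec := Nat.find_spec (exists_lt_minLen l)
  rw [hk] at hspec
  exact ⟨k, not_lt.1 (Nat.find_min (exists_lt_minLen l) (hk ▸ k.lt_succ_self)), hspec⟩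

end MinLen

/-! ### The lamp groups -/

/-- The product over `k` of the groups of functions from `ℤ` to the free solvable group of rank
two and derived length `k`. -/
abbrev LampBase : Type := (k : ℕ) → ℤ → FreeGroup (Fin 2) ⧸ derivedSeries (FreeGroup (Fin 2)) k

/-- The simultaneous translation action of `ℤ` on the factors of `LampBase`. -/
def lampShift : Multiplicative ℤ →* MulAut LampBase where
  toFun t :=
    { toFun := fun h k n => h k (n - t.toAdd)
      invFun := fun h k n => h k (n + t.toAdd)
      left_inv := fun h => by ext; simp
      right_inv := fun h => by ext; simp
      map_mul' := fun _ _ => rfl }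
  map_one' := by ext; simp
  map_mul' s t := by ext h k n; simp [sub_sub]

/-- A diagonal version of the unrestricted wreath product, containing the groups `LampGroup d`. -/
abbrev LampAmbient : Type := LampBase ⋊[lampShift] Multiplicative ℤ

/-- The image of the `i`-th generator in the free solvable group of derived length `k`. -/
abbrev solvGen (k : ℕ) (i : Fin 2) : FreeGroup (Fin 2) ⧸ derivedSeries (FreeGroup (Fin 2)) k :=
  QuotientGroup.mk (FreeGroup.of i)

/-- The lamp configuration with the lamp `solvGen k i` at position `d k`, for every `k`. -/
def lamp (i : Fin 2) (d : ℕ → ℕ) : LampBase := fun k => Pi.mulSingle (d k : ℤ) (solvGen k i)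

/-- The generators of `LampGroup d`. -/
def lampGens (d : ℕ → ℕ) : Set LampAmbient :=
  {.inl (lamp 0 0), .inl (lamp 1 d), .inr (Multiplicative.ofAdd 1)}

/-- The group generated by two lamps, whose distance in the `k`-th factor is `d k`, and a
translation. -/
abbrev LampGroup (d : ℕ → ℕ) : Type := Subgroup.closure (lampGens d)

/-- The generating set of `LampGroup d`. -/
def lampGroupGens (d : ℕ → ℕ) : Set (LampGroup d) := Subtype.val ⁻¹' lampGens d

theorem finite_lampGroupGens (d : ℕ → ℕ) : (lampGroupGens d).Finite :=
  Set.Finite.preimage Subtype.val_injective.injOn (by simp [lampGens])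

theorem closure_lampGroupGens (d : ℕ → ℕ) : Subgroup.closure (lampGroupGens d) = ⊤ :=
  Subgroup.closure_closure_coe_preimage

/-- The lamps of `g` in the `k`-th factor at distance more than `m` from `d k`, respectively `0`,
are powers of the first, respectively second, generator. -/
def IsNear (d : ℕ → ℕ) (m : ℕ) (g : LampAmbient) : Prop :=
  ∀ (k : ℕ) (n : ℤ), ((m : ℤ) < |n - d k| → g.left k n ∈ Subgroup.zpowers (solvGen k 0)) ∧
    ((m : ℤ) < |n| → g.left k n ∈ Subgroup.zpowers (solvGen k 1))

theorem IsNear.mul {d : ℕ → ℕ} {m : ℕ} {g h : LampAmbient} (hg : IsNear d 0 g)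
    (hr : |g.right.toAdd| ≤ 1) (hh : IsNear d m h) : IsNear d (m + 1) (g * h) := by
  intro k n
  have hleft : (g * h).left k n = g.left k n * h.left k (n - g.right.toAdd) := rfl
  rw [hleft]
  rw [abs_le] at hr
  push_cast
  refine ⟨fun hn => mul_mem ((hg k n).1 ?_) ((hh k _).1 ?_),
    fun hn => mul_mem ((hg k n).2 ?_) ((hh k _).2 ?_)⟩
  all_goals push_cast; rw [lt_abs] at hn ⊢; omega

theorem isNear_zero_of_left_eq_one {d : ℕ → ℕ} {g : LampAmbient} (hg : g.left = 1) :
    IsNear d 0 g := by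
  intro k n
  simp [hg]

theorem isNear_zero_inl {d : ℕ → ℕ} {h : LampBase}
    (hh : h = lamp 0 0 ∨ h = lamp 1 d) : IsNear d 0 (.inl h) := by
  intro k n
  simp only [SemidirectProduct.left_inl, Nat.cast_zero, abs_pos]
  obtain rfl | rfl := hh
  · refine ⟨fun _ => ?_, fun hn => ?_⟩
    · obtain rfl | hn := eq_or_ne n 0 <;> simp [lamp, *]
    · simp [lamp, hn]
  · refine ⟨fun hn => ?_, fun _ => ?_⟩
    · simp [lamp, sub_ne_zero.1 hn]
    · obtain rfl | hn := eq_or_ne n (d k) <;> simp [lamp, *]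

theorem IsNear.inl_inv {d : ℕ → ℕ} {m : ℕ} {h : LampBase} (hh : IsNear d m (.inl h)) :
    IsNear d m (.inl h)⁻¹ := by
  rw [← map_inv]
  exact fun k n => ⟨fun hn => inv_mem ((hh k n).1 hn), fun hn => inv_mem ((hh k n).2 hn)⟩

theorem HasWord.isNear {d : ℕ → ℕ} {m : ℕ} {g : LampAmbient} (hg : HasWord (lampGens d) m g) :
    IsNear d m g := by
  obtain ⟨L, rfl, hL, rfl⟩ := hg
  induction L with
  | nil => exact isNear_zero_of_left_eq_one rfl
  | cons x L ih =>
    rw [List.forall_mem_cons] at hL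
    rw [List.prod_cons, List.length_cons]
    suffices h : IsNear d 0 x ∧ |x.right.toAdd| ≤ 1 from h.1.mul h.2 (ih hL.2)
    obtain (rfl | rfl | rfl) | hx := hL.1
    · exact ⟨isNear_zero_inl (.inl rfl), by simp⟩
    · exact ⟨isNear_zero_inl (.inr rfl), by simp⟩
    · exact ⟨isNear_zero_of_left_eq_one rfl, by simp⟩
    · obtain ⟨y, rfl⟩ : ∃ y, x = y⁻¹ := ⟨x⁻¹, (inv_inv x).symm⟩
      rw [inv_inv] at hx
      obtain rfl | rfl | rfl := hx
      · exact ⟨(isNear_zero_inl (.inl rfl)).inl_inv, by simp⟩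
      · exact ⟨(isNear_zero_inl (.inr rfl)).inl_inv, by simp⟩
      · exact ⟨isNear_zero_of_left_eq_one (by simp), by simp⟩

theorem lift_inl_left_apply (a b : LampBase) (w : FreeGroup (Fin 2)) (k : ℕ) (n : ℤ) :
    (FreeGroup.lift ![(.inl a : LampAmbient), .inl b] w).left k n =
      FreeGroup.lift ![a k n, b k n] w := by
  have h : ![(.inl a : LampAmbient), .inl b] = SemidirectProduct.inl ∘ ![a, b] := by
    ext i : 1; fin_cases i <;> rfl
  rw [h, ← map_lift_apply, SemidirectProduct.left_inl]
  change (Pi.evalMonoidHom _ n).comp (Pi.evalMonoidHom _ k) (FreeGroup.lift ![a, b] w) = _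
  rw [map_lift_apply]
  congr 2
  ext i : 1; fin_cases i <;> rfl

theorem lift_eq_one_of_isNear {d : ℕ → ℕ} {K m : ℕ} (hK : 1 ≤ K) (hd : ∀ k, K < k → 2 * m < d k)
    {u v : LampAmbient} (hu : IsNear d m u) (hv : IsNear d m v) (hur : u.right = 1)
    (hvr : v.right = 1) {w : FreeGroup (Fin 2)} (hw : w ∈ derivedSeries (FreeGroup (Fin 2)) K) :
    FreeGroup.lift ![u, v] w = 1 := by
  obtain ⟨a, s⟩ := u
  obtain ⟨b, t⟩ := v
  obtain rfl : s = 1 := hur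
  obtain rfl : t = 1 := hvr
  change FreeGroup.lift ![(.inl a : LampAmbient), .inl b] w = 1
  refine SemidirectProduct.ext (funext fun k => funext fun n => ?_) ?_
  · rw [lift_inl_left_apply]
    obtain hk | hk := le_or_gt k K
    · have hmem := map_derivedSeries_le_derivedSeries (FreeGroup.lift ![a k n, b k n]) k
        ⟨w, derivedSeries_antitone _ hk hw, rfl⟩
      rwa [← map_derivedSeries_eq (QuotientGroup.mk'_surjective _) k,
        QuotientGroup.map_mk'_self, Subgroup.mem_bot] at hmem
    · have hw1 := derivedSeries_antitone _ hK hw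
      have hdk := hd k hk
      obtain hn | hn := lt_or_ge (m : ℤ) |n - d k|
      · exact lift_eq_one_of_mem_zpowers ((hu k n).1 hn) ((hv k n).1 hn) hw1
      · have hn' : (m : ℤ) < |n| := by
          rw [abs_le] at hn
          rw [lt_abs]
          omega
        exact lift_eq_one_of_mem_zpowers ((hu k n).2 hn') ((hv k n).2 hn') hw1
  · change SemidirectProduct.rightHom _ = _
    rw [map_lift_apply, show SemidirectProduct.rightHom ∘ ![(.inl a : LampAmbient), .inl b] =
      fun _ => 1 by ext i : 1; fin_cases i <;> rfl]
    exact DFunLike.congr_fun (FreeGroup.ext_hom (FreeGroup.lift fun _ => 1) 1 (by simp)) w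

/-! ### The lawlessness growth of the lamp groups -/

theorem exists_lift_ne_one (d : ℕ → ℕ) {k : ℕ} {w : FreeGroup (Fin 2)} (hw1 : w ≠ 1)
    (hw : wordLen w < minLen k) :
    ∃ g : Fin 2 → LampGroup d, FreeGroup.lift g w ≠ 1 ∧
      ∑ i, wlen (lampGroupGens d) (g i) ≤ 2 + 2 * d k := by
  set a : LampGroup d := ⟨.inl (lamp 0 0), Subgroup.subset_closure (by simp [lampGens])⟩
  set b : LampGroup d := ⟨.inl (lamp 1 d), Subgroup.subset_closure (by simp [lampGens])⟩ with hb
  set t : LampGroup d := ⟨.inr (.ofAdd 1), Subgroup.subset_closure (by simp [lampGens])⟩ with ht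
  have haS : a ∈ lampGroupGens d := Or.inl rfl
  have hbS : b ∈ lampGroupGens d := Or.inr (Or.inl rfl)
  have htS : t ∈ lampGroupGens d := Or.inr (Or.inr rfl)
  refine ⟨![a, (t ^ d k)⁻¹ * b * t ^ d k], fun h => ?_, ?_⟩
  · have hconj : (((t ^ d k)⁻¹ * b * t ^ d k : LampGroup d) : LampAmbient) =
        .inl (lampShift (.ofAdd (-(d k : ℤ))) (lamp 1 d)) := by
      rw [SemidirectProduct.inl_aut]
      simp [hb, ht, ← map_pow, ← ofAdd_nsmul]
    have h' := congrArg (Subgroup.closure (lampGens d)).subtype h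
    rw [map_lift_apply, map_one] at h'
    have hval : (Subgroup.closure (lampGens d)).subtype ∘ ![a, (t ^ d k)⁻¹ * b * t ^ d k] =
        ![.inl (lamp 0 0), .inl (lampShift (.ofAdd (-(d k : ℤ))) (lamp 1 d))] := by
      ext i : 1
      fin_cases i
      exacts [rfl, hconj]
    rw [hval] at h'
    have h0 := congrArg (fun g : LampAmbient => g.left k 0) h'
    simp only [lift_inl_left_apply] at h0
    have hgen : ![lamp 0 0 k 0, lampShift (.ofAdd (-(d k : ℤ))) (lamp 1 d) k 0] =
        QuotientGroup.mk' (derivedSeries (FreeGroup (Fin 2)) k) ∘ FreeGroup.of := by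
      ext i : 1
      fin_cases i <;> simp [lamp, lampShift]
    rw [hgen, ← map_lift_apply, FreeGroup.lift_of_apply] at h0
    exact hw.not_ge (minLen_le ((QuotientGroup.eq_one_iff w).1 h0) hw1)
  · have h1 := wlen_le (HasWord.of_mem haS)
    have h2 := wlen_le (((HasWord.pow htS (d k)).inv.mul (.of_mem hbS)).mul (.pow htS (d k)))
    rw [Fin.sum_univ_two]
    simp only [Matrix.cons_val_zero, Matrix.cons_val_one]
    omega

theorem chi_le (d : ℕ → ℕ) {k : ℕ} {w : FreeGroup (Fin 2)} (hw1 : w ≠ 1)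
    (hw : wordLen w < minLen k) : chi (lampGroupGens d) w ≤ 2 + 2 * d k := by
  obtain ⟨g, hg, hle⟩ := exists_lift_ne_one d hw1 hw
  refine le_trans (Nat.sInf_le ?_) hle
  exact ⟨g, hg, rfl⟩

theorem le_chi_commHom {d : ℕ → ℕ} (hd : Monotone d) {K : ℕ} (hK : 1 ≤ K)
    {w : FreeGroup (Fin 2)} (hw : w ∈ derivedSeries (FreeGroup (Fin 2)) K) (hw1 : w ≠ 1) :
    d (K + 1) ≤ 4 * chi (lampGroupGens d) (FreeGroup.commHom w) := by
  obtain ⟨k, hk⟩ := exists_lt_minLen (wordLen (FreeGroup.commHom w))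
  obtain ⟨g₀, hg₀, -⟩ := exists_lift_ne_one d (FreeGroup.commHom_ne_one hw1) hk
  obtain ⟨g, hg, hc⟩ : chi (lampGroupGens d) (FreeGroup.commHom w) ∈
      {c | ∃ g : Fin 2 → LampGroup d, FreeGroup.lift g (FreeGroup.commHom w) ≠ 1 ∧
        c = ∑ i, wlen (lampGroupGens d) (g i)} :=
    Nat.sInf_mem ⟨_, g₀, hg₀, rfl⟩
  rw [hc, Fin.sum_univ_two]
  by_contra! hlt
  refine hg (Subtype.val_injective ?_)
  change (Subgroup.closure (lampGens d)).subtype _ = 1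
  have hword (i : Fin 2) := (hasWord_wlen (closure_lampGroupGens d) (g i)).map
    (Subgroup.closure (lampGens d)).subtype (T := lampGens d) fun x hx => hx
  rw [map_lift_apply, lift_commHom]
  refine lift_eq_one_of_isNear hK (fun k hk => ?_) ((hword 0).commutator (hword 1)).isNear
    ((hword 0).inv.commutator (hword 1).inv).isNear ?_ ?_ hw
  · have : d (K + 1) ≤ d k := hd (Nat.succ_le_of_lt hk)
    omega
  all_goals
    rw [← SemidirectProduct.rightHom_eq_right, map_commutatorElement,
      commutatorElement_eq_one_iff_mul_comm, mul_comm]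

theorem isLawless_lampGroup (d : ℕ → ℕ) : IsLawless (LampGroup d) := by
  intro k w hw hlaw
  have hinj := (FreeGroup.injective_lift_conj k).comp
    (FreeGroup.map_injective (Fin.castLE_injective (Nat.le_add_right k 2)))
  set φ := (FreeGroup.lift fun i : Fin (k + 2) =>
      FreeGroup.of (0 : Fin 2) ^ (i : ℕ) * .of 1 * (.of 0 ^ (i : ℕ))⁻¹).comp
    (FreeGroup.map (Fin.castLE (Nat.le_add_right k 2)))
  have hφ : φ w ≠ 1 := (map_ne_one_iff φ hinj).2 hw
  obtain ⟨c, hc⟩ := exists_lt_minLen (wordLen (φ w))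
  obtain ⟨g, hg, -⟩ := exists_lift_ne_one d hφ hc
  refine hg (Eq.trans ?_ (hlaw fun i => FreeGroup.lift g (φ (.of i))))
  exact DFunLike.congr_fun (FreeGroup.ext_hom ((FreeGroup.lift g).comp φ) (FreeGroup.lift _)
    (by simp)) w

theorem lawGrowth_le_s3 (d : ℕ → ℕ) {k l : ℕ} (hl : l < minLen k) :
    lawGrowth (lampGroupGens d) l ≤ 2 + 2 * d k := by
  refine csSup_le' ?_
  rintro _ ⟨w, hw1, hw, rfl⟩
  exact chi_le d hw1 (hw.trans_lt hl)

theorem chi_le_lawGrowth_s3 (d : ℕ → ℕ) {l : ℕ} {w : FreeGroup (Fin 2)} (hw1 : w ≠ 1)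
    (hw : wordLen w ≤ l) : chi (lampGroupGens d) w ≤ lawGrowth (lampGroupGens d) l := by
  obtain ⟨k, hk⟩ := exists_lt_minLen l
  refine le_csSup ⟨2 + 2 * d k, ?_⟩ ⟨w, hw1, hw, rfl⟩
  rintro _ ⟨w, hw1, hw, rfl⟩
  exact chi_le d hw1 (hw.trans_lt hk)

/-- If `f` is unbounded, nondecreasing, and `f(Mn) ≥ M·f(n)` for some
`M ≥ 2` and all `n`, then there is a lawless group `Γ` generated by a finite set `S`
with `𝒜_Γ^S ≈ f`. -/
theorem stmt3 (f : ℕ → ℕ)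
    (hmono : ∀ ⦃m n : ℕ⦄, 1 ≤ m → m ≤ n → f m ≤ f n)
    (hunb : ∀ N : ℕ, ∃ n : ℕ, 1 ≤ n ∧ N ≤ f n)
    (hM : ∃ M : ℕ, 2 ≤ M ∧ ∀ n : ℕ, 1 ≤ n → M * f n ≤ f (M * n)) :
    ∃ (Γ : Type) (_ : Group Γ) (S : Set Γ),
      S.Finite ∧ Subgroup.closure S = ⊤ ∧ IsLawless Γ ∧ EquivGrowth (lawGrowth S) f := by
  obtain ⟨n₁, hn₁, hfn₁⟩ := hunb 1
  set d : ℕ → ℕ := fun k => f (minLen (k - 1))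
  have hdmono : Monotone d := fun j k hjk =>
    hmono (one_le_minLen _) (minLen_mono (Nat.sub_le_sub_right hjk 1))
  refine ⟨LampGroup d, inferInstance, lampGroupGens d, finite_lampGroupGens d,
    closure_lampGroupGens d, isLawless_lampGroup d, ⟨4 * n₁, by omega, fun l hl => ?_⟩,
    ⟨16, by omega, fun l hl => ?_⟩⟩
  · obtain ⟨k, hkl, hlk⟩ := exists_minLen_le_lt hl
    have h1 : 1 ≤ f (4 * n₁ * l) := hfn₁.trans (hmono hn₁ (by nlinarith))
    have h2 : d (k + 1) ≤ f (4 * n₁ * l) :=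
      hmono (one_le_minLen _) (hkl.trans (by nlinarith))
    calc lawGrowth (lampGroupGens d) l ≤ 2 + 2 * d (k + 1) := lawGrowth_le_s3 d hlk
      _ ≤ 4 * f (4 * n₁ * l) := by omega
      _ ≤ 4 * n₁ * f (4 * n₁ * l) := Nat.mul_le_mul_right _ (by omega)
  · obtain ⟨k, hkl, hlk⟩ := exists_minLen_le_lt hl
    obtain ⟨w, hw, hw1, hwk⟩ := exists_wordLen_eq_minLen (k + 1)
    have hlen : wordLen (FreeGroup.commHom w) ≤ 16 * l := by
      have := minLen_succ_le k
      rw [wordLen] at hwk ⊢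
      rw [FreeGroup.length_toWord_commHom]
      omega
    have h1 : f l ≤ d (k + 2) := hmono hl hlk.le
    have h2 : d (k + 2) ≤ 4 * chi (lampGroupGens d) (FreeGroup.commHom w) :=
      le_chi_commHom hdmono (Nat.le_add_left 1 k) hw hw1
    have h3 := chi_le_lawGrowth_s3 d (FreeGroup.commHom_ne_one hw1) hlen
    omega
end
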